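/- arXiv:2112.07275 — 8 statements merged into one kernel-verified Lean document; each statement's English description precedes it below -/
import Mathlib

section
/- Let μ and ν be probability measures on compact subsets X and Y of ℝ^d, and let f₀ : ℝ^d → ℝ be a convex differentiable function such that the pushforward of μ under ∇f₀ equals ν. Then for every convex function f : ℝ^d → ℝ one has J_{μ,ν}(f) ≥ J_{μ,ν}(f₀), where the integral of f* against ν is taken in (−∞, +∞]; i.e., the Brenier potential f₀ minimizes the semi-dual Brenier objective among convex functions. -/
open MeasureTheory
open scoped RealInnerProductSpace

noncomputable def conj {d : ℕ} (f : EuclideanSpace ℝ (Fin d) → ℝ)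
    (y : EuclideanSpace ℝ (Fin d)) : EReal :=
  ⨆ x : EuclideanSpace ℝ (Fin d), ((⟪x, y⟫ - f x : ℝ) : EReal)

open Classical in
/-- Integral of an `EReal`-valued function, valued in `(-∞, +∞]`:
it is the Bochner integral when the function is a.e. finite and integrable, `+∞` otherwise. -/
noncomputable def eintegral {d : ℕ} (ν : Measure (EuclideanSpace ℝ (Fin d)))
    (g : EuclideanSpace ℝ (Fin d) → EReal) : EReal :=
  if (∀ᵐ y ∂ν, g y ≠ ⊤) ∧ Integrable (fun y => (g y).toReal) ν
  then ((∫ y, (g y).toReal ∂ν : ℝ) : EReal) else ⊤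

/-- The semi-dual Brenier objective `J_{μ,ν}(f) = ∫ f dμ + ∫ f* dν`. -/
noncomputable def Jsd {d : ℕ} (μ ν : Measure (EuclideanSpace ℝ (Fin d)))
    (f : EuclideanSpace ℝ (Fin d) → ℝ) : EReal :=
  ((∫ x, f x ∂μ : ℝ) : EReal) + eintegral ν (conj f)

lemma aux_subgrad {d : ℕ} (f₀ : EuclideanSpace ℝ (Fin d) → ℝ) (v x z : EuclideanSpace ℝ (Fin d))
    (hconv : ConvexOn ℝ Set.univ f₀) (hgrad : HasGradientAt f₀ v x) :
    f₀ x + ⟪z - x, v⟫ ≤ f₀ z := by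
  have hc : ConvexOn ℝ Set.univ (f₀ ∘ (AffineMap.lineMap x z : ℝ →ᵃ[ℝ] EuclideanSpace ℝ (Fin d))) := by
    simpa using hconv.comp_affineMap (AffineMap.lineMap x z : ℝ →ᵃ[ℝ] EuclideanSpace ℝ (Fin d))
  have hl : HasDerivAt (AffineMap.lineMap x z : ℝ → EuclideanSpace ℝ (Fin d)) (z - x) (0:ℝ) :=
    AffineMap.hasDerivAt_lineMap
  have hd : HasDerivAt (f₀ ∘ (AffineMap.lineMap x z : ℝ →ᵃ[ℝ] EuclideanSpace ℝ (Fin d)))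
      (⟪v, z - x⟫) (0:ℝ) := by
    have h2 : HasFDerivAt f₀ (InnerProductSpace.toDual ℝ _ v)
        ((AffineMap.lineMap x z : ℝ →ᵃ[ℝ] EuclideanSpace ℝ (Fin d)) 0) := by
      simpa using hgrad.hasFDerivAt
    simpa using h2.comp_hasDerivAt (0:ℝ) hl
  have := hc.le_slope_of_hasDerivAt (Set.mem_univ 0) (Set.mem_univ 1) one_pos hd
  simp [slope_def_field] at this
  rw [real_inner_comm]
  linarith

lemma aux_conj_le {d : ℕ} (f : EuclideanSpace ℝ (Fin d) → ℝ) (x y : EuclideanSpace ℝ (Fin d)) :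
    ((⟪x, y⟫ - f x : ℝ) : EReal) ≤ conj f y :=
  le_iSup (fun x : EuclideanSpace ℝ (Fin d) => ((⟪x, y⟫ - f x : ℝ) : EReal)) x

lemma aux_conj_grad {d : ℕ} (f₀ : EuclideanSpace ℝ (Fin d) → ℝ) (v x : EuclideanSpace ℝ (Fin d))
    (hconv : ConvexOn ℝ Set.univ f₀) (hgrad : HasGradientAt f₀ v x) :
    conj f₀ v = ((⟪x, v⟫ - f₀ x : ℝ) : EReal) := by
  refine le_antisymm (iSup_le fun z => ?_) (aux_conj_le f₀ x v)
  have := aux_subgrad f₀ v x z hconv hgrad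
  rw [inner_sub_left] at this
  exact EReal.coe_le_coe_iff.2 (by linarith)

lemma aux_meas {d : ℕ} (f : EuclideanSpace ℝ (Fin d) → ℝ) : Measurable (conj f) := by
  apply LowerSemicontinuous.measurable
  unfold conj
  refine lowerSemicontinuous_iSup fun x => Continuous.lowerSemicontinuous ?_
  exact continuous_coe_real_ereal.comp (by fun_prop)

lemma aux_int {d : ℕ} (X : Set (EuclideanSpace ℝ (Fin d))) (hX : IsCompact X)
    (μ : Measure (EuclideanSpace ℝ (Fin d))) [IsProbabilityMeasure μ] (hμX : μ Xᶜ = 0)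
    (f : EuclideanSpace ℝ (Fin d) → ℝ) (hf : ConvexOn ℝ Set.univ f) : Integrable f μ := by
  have hc : Continuous f := by
    rw [← continuousOn_univ]; exact hf.continuousOn isOpen_univ
  obtain ⟨C, hC⟩ := hX.exists_bound_of_continuousOn hc.continuousOn
  refine Integrable.of_bound hc.aestronglyMeasurable C ?_
  have : ∀ᵐ x ∂μ, x ∈ X := by rw [ae_iff]; exact hμX
  filter_upwards [this] with x hx using hC x hx

/-- The Brenier potential `f₀` minimizes the semi-dual Brenier objective
`J_{μ,ν}` among all convex functions (the integral of `f*` against `ν` being taken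
in `(-∞, +∞]`). -/
theorem stmt_1 {d : ℕ} (X Y : Set (EuclideanSpace ℝ (Fin d)))
    (hX : IsCompact X) (hY : IsCompact Y)
    (μ ν : Measure (EuclideanSpace ℝ (Fin d)))
    [IsProbabilityMeasure μ] [IsProbabilityMeasure ν]
    (hμX : μ Xᶜ = 0) (hνY : ν Yᶜ = 0)
    (f₀ : EuclideanSpace ℝ (Fin d) → ℝ)
    (T₀ : EuclideanSpace ℝ (Fin d) → EuclideanSpace ℝ (Fin d))
    (hconv : ConvexOn ℝ Set.univ f₀)
    (hgrad : ∀ x, HasGradientAt f₀ (T₀ x) x)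
    (hpush : Measure.map T₀ μ = ν) :
    ∀ f : EuclideanSpace ℝ (Fin d) → ℝ, ConvexOn ℝ Set.univ f →
      Jsd μ ν f₀ ≤ Jsd μ ν f := by
  intro f hf
  have hT : AEMeasurable T₀ μ := by
    by_contra h
    rw [Measure.map_of_not_aemeasurable h] at hpush
    exact IsProbabilityMeasure.ne_zero ν hpush.symm
  have hXae : ∀ᵐ x ∂μ, x ∈ X := by rw [ae_iff]; exact hμX
  have hYae : ∀ᵐ x ∂μ, T₀ x ∈ Y := by
    apply ae_of_ae_map hT
    rw [hpush, ae_iff]; exact hνY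
  have hif0 := aux_int X hX μ hμX f₀ hconv
  have hif := aux_int X hX μ hμX f hf
  have hinner : Integrable (fun x => ⟪x, T₀ x⟫) μ := by
    obtain ⟨C, hC⟩ := hX.exists_bound_of_continuousOn (f := id) continuousOn_id
    obtain ⟨D, hD⟩ := hY.exists_bound_of_continuousOn (f := id) continuousOn_id
    refine Integrable.of_bound (aemeasurable_id.inner hT).aestronglyMeasurable (C * D) ?_
    filter_upwards [hXae, hYae] with x hx hy
    have h1 := hC x hx
    have h2 := hD _ hy
    simp only [id] at h1 h2
    exact (norm_inner_le_norm _ _).trans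
      (mul_le_mul h1 h2 (norm_nonneg _) ((norm_nonneg _).trans h1))
  have hg0 : ∀ x, conj f₀ (T₀ x) = ((⟪x, T₀ x⟫ - f₀ x : ℝ) : EReal) := fun x =>
    aux_conj_grad f₀ _ x hconv (hgrad x)
  have hm : ∀ g : EuclideanSpace ℝ (Fin d) → ℝ,
      Measurable (fun y => (conj g y).toReal) := fun g =>
    (aux_meas g).ereal_toReal
  have hI : ∀ g : EuclideanSpace ℝ (Fin d) → ℝ,
      ∫ y, (conj g y).toReal ∂ν = ∫ x, (conj g (T₀ x)).toReal ∂μ := fun g => by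
    rw [← hpush, integral_map hT (hm g).aestronglyMeasurable]
  have hA : (∀ᵐ y ∂ν, conj f₀ y ≠ ⊤) ∧ Integrable (fun y => (conj f₀ y).toReal) ν := by
    constructor
    · rw [← hpush, ae_map_iff (p := fun y => conj f₀ y ≠ ⊤) hT ((aux_meas f₀) (measurableSet_singleton ⊤).compl)]
      exact Filter.Eventually.of_forall fun x => by rw [hg0]; exact EReal.coe_ne_top _
    · rw [← hpush, integrable_map_measure (hm f₀).aestronglyMeasurable hT]
      refine (hinner.sub hif0).congr (Filter.Eventually.of_forall fun x => ?_)
      simp only [Function.comp, hg0, EReal.toReal_coe, Pi.sub_apply]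
  unfold Jsd eintegral
  rw [if_pos hA]
  split_ifs with hB
  · rw [← EReal.coe_add, ← EReal.coe_add, EReal.coe_le_coe_iff, hI, hI]
    have hfin : ∀ᵐ x ∂μ, conj f (T₀ x) ≠ ⊤ := by
      apply ae_of_ae_map (p := fun y => conj f y ≠ ⊤) hT
      rw [hpush]; exact hB.1
    have hint : Integrable (fun x => (conj f (T₀ x)).toReal) μ := by
      have := hB.2
      rw [← hpush, integrable_map_measure (hm f).aestronglyMeasurable hT] at this
      exact this
    simp only [hg0, EReal.toReal_coe]
    rw [integral_sub hinner hif0, ← integral_add hif hint, add_sub_cancel]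
    refine integral_mono_ae hinner (hif.add hint) ?_
    filter_upwards [hfin] with x hx
    have h1 := EReal.toReal_le_toReal (aux_conj_le f x (T₀ x)) (EReal.coe_ne_bot _) hx
    rw [EReal.toReal_coe] at h1
    linarith
  · rw [EReal.coe_add_top]
    exact le_top
end

section
/- Let μ and ν be probability measures on compact subsets X and Y of ℝ^d, and assume there exists a convex differentiable function f₀ : ℝ^d → ℝ with (∇f₀)_#μ = ν; set T₀ = ∇f₀. Let f : ℝ^d → ℝ be a C¹, γ-strongly convex function whose gradient is M-Lipschitz (0 < γ ≤ M). Then (1/(2M)) ∫ ‖∇f(x) − T₀(x)‖² dμ(x) ≤ J_{μ,ν}(f) − J_{μ,ν}(f₀). -/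
open MeasureTheory
open scoped RealInnerProductSpace

lemma line_hasDeriv {d : ℕ} {f : EuclideanSpace ℝ (Fin d) → ℝ}
    {T : EuclideanSpace ℝ (Fin d) → EuclideanSpace ℝ (Fin d)}
    (h : ∀ x, HasGradientAt f (T x) x) (x v : EuclideanSpace ℝ (Fin d)) (t : ℝ) :
    HasDerivAt (fun t : ℝ => f (x + t • v)) ⟪T (x + t • v), v⟫ t := by
  have h1 : HasDerivAt (fun t : ℝ => x + t • v) v t := by
    simpa using ((hasDerivAt_id t).smul_const v).const_add x
  have h2 := (h (x + t • v)).hasFDerivAt.comp_hasDerivAt t h1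
  rw [InnerProductSpace.toDual_apply_apply] at h2
  exact h2

lemma descent {d : ℕ} {f : EuclideanSpace ℝ (Fin d) → ℝ}
    {T : EuclideanSpace ℝ (Fin d) → EuclideanSpace ℝ (Fin d)}
    (h : ∀ x, HasGradientAt f (T x) x) {M : ℝ}
    (hlip : ∀ a b, ‖T a - T b‖ ≤ M * ‖a - b‖) (x v : EuclideanSpace ℝ (Fin d)) :
    f (x + v) ≤ f x + ⟪T x, v⟫ + M / 2 * ‖v‖ ^ 2 := by
  let g : ℝ → ℝ := fun t => f (x + t • v) - t * ⟪T x, v⟫ - t ^ 2 * (M / 2 * ‖v‖ ^ 2)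
  have hg : ∀ t, HasDerivAt g (⟪T (x + t • v), v⟫ - ⟪T x, v⟫ - 2 * t * (M / 2 * ‖v‖ ^ 2)) t := by
    intro t
    have h3 := ((line_hasDeriv h x v t).sub ((hasDerivAt_id t).mul_const ⟪T x, v⟫)).sub
      ((hasDerivAt_pow 2 t).mul_const (M / 2 * ‖v‖ ^ 2))
    refine HasDerivAt.congr_deriv h3 ?_
    norm_num
  have hanti : AntitoneOn g (Set.Icc 0 1) := by
    apply antitoneOn_of_deriv_nonpos (convex_Icc 0 1)
    · exact fun t _ => (hg t).continuousAt.continuousWithinAt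
    · exact fun t _ => (hg t).differentiableAt.differentiableWithinAt
    · intro t ht
      rw [interior_Icc] at ht
      rw [(hg t).deriv, ← inner_sub_left]
      have h4 := real_inner_le_norm (T (x + t • v) - T x) v
      have h5 := hlip (x + t • v) x
      rw [add_sub_cancel_left, norm_smul, Real.norm_of_nonneg ht.1.le] at h5
      have h6 := mul_le_mul_of_nonneg_right h5 (norm_nonneg v)
      nlinarith
  have := hanti (Set.left_mem_Icc.2 zero_le_one) (Set.right_mem_Icc.2 zero_le_one) zero_le_one
  simp only [g] at this
  simp at this
  linarith

lemma convex_grad {d : ℕ} {f : EuclideanSpace ℝ (Fin d) → ℝ}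
    {T : EuclideanSpace ℝ (Fin d) → EuclideanSpace ℝ (Fin d)}
    (hc : ConvexOn ℝ Set.univ f)
    (h : ∀ x, HasGradientAt f (T x) x) (x z : EuclideanSpace ℝ (Fin d)) :
    f x + ⟪T x, z - x⟫ ≤ f z := by
  have h1 := line_hasDeriv h x (z - x) 0
  have hc' : ConvexOn ℝ Set.univ (fun t : ℝ => f (x + t • (z - x))) := by
    have := hc.comp_affineMap (AffineMap.lineMap x z : ℝ →ᵃ[ℝ] EuclideanSpace ℝ (Fin d))
    simp only [Set.preimage_univ] at this
    have he : (fun t : ℝ => f (x + t • (z - x))) = f ∘ (AffineMap.lineMap x z : ℝ →ᵃ[ℝ] _) := by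
      funext t
      simp [AffineMap.lineMap_apply, add_comm]
    rw [he]
    exact this
  have h2 := hc'.le_slope_of_hasDerivAt (Set.mem_univ 0) (Set.mem_univ 1) zero_lt_one h1
  simp [slope_def_field] at h2
  linarith

lemma conj_grad {d : ℕ} {f : EuclideanSpace ℝ (Fin d) → ℝ}
    {T : EuclideanSpace ℝ (Fin d) → EuclideanSpace ℝ (Fin d)}
    (hc : ConvexOn ℝ Set.univ f)
    (h : ∀ x, HasGradientAt f (T x) x) (x : EuclideanSpace ℝ (Fin d)) :
    conj f (T x) = ((⟪x, T x⟫ - f x : ℝ) : EReal) := by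
  apply le_antisymm
  · refine iSup_le fun z => EReal.coe_le_coe_iff.2 ?_
    have := convex_grad hc h x z
    rw [inner_sub_right, real_inner_comm, real_inner_comm x] at this
    linarith
  · exact le_iSup (fun z => ((⟪z, T x⟫ - f z : ℝ) : EReal)) x

lemma conj_measurable {d : ℕ} {f : EuclideanSpace ℝ (Fin d) → ℝ} :
    Measurable (conj f) := by
  have : LowerSemicontinuous (conj f) := by
    apply lowerSemicontinuous_iSup
    intro x
    apply Continuous.lowerSemicontinuous
    exact continuous_coe_real_ereal.comp (by fun_prop)
  exact this.measurable

lemma conj_lower {d : ℕ} {f : EuclideanSpace ℝ (Fin d) → ℝ}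
    {T : EuclideanSpace ℝ (Fin d) → EuclideanSpace ℝ (Fin d)}
    (h : ∀ x, HasGradientAt f (T x) x) {M : ℝ} (hM : 0 < M)
    (hlip : ∀ a b, ‖T a - T b‖ ≤ M * ‖a - b‖) (x y : EuclideanSpace ℝ (Fin d)) :
    ((⟪x, y⟫ - f x + 1 / (2 * M) * ‖T x - y‖ ^ 2 : ℝ) : EReal) ≤ conj f y := by
  refine le_trans (EReal.coe_le_coe_iff.2 ?_)
    (le_iSup (fun z => ((⟪z, y⟫ - f z : ℝ) : EReal)) (x + (1 / M) • (y - T x)))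
  have h1 := descent h hlip x ((1 / M) • (y - T x))
  have h2 : ⟪y - T x, y⟫ - ⟪T x, y - T x⟫ = ‖T x - y‖ ^ 2 := by
    rw [norm_sub_rev, ← real_inner_self_eq_norm_sq, inner_sub_right (y - T x),
      real_inner_comm (T x)]
  rw [norm_smul, mul_pow, Real.norm_of_nonneg (by positivity), inner_smul_right,
    norm_sub_rev] at h1
  rw [inner_add_left, real_inner_smul_left]
  have h3 : M / 2 * ((1 / M) ^ 2 * ‖T x - y‖ ^ 2) = 1 / (2 * M) * ‖T x - y‖ ^ 2 := by
    field_simp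
  have h4 : 1 / M * ⟪y - T x, y⟫ - 1 / M * ⟪T x, y - T x⟫ = 2 * (1 / (2 * M) * ‖T x - y‖ ^ 2) := by
    rw [← mul_sub, h2]; field_simp
  linarith

/-- lower bound `(1/(2M)) ∫ ‖∇f - T₀‖² dμ ≤ J(f) - J(f₀)`. -/
theorem stmt_3 {d : ℕ} (X Y : Set (EuclideanSpace ℝ (Fin d)))
    (hX : IsCompact X) (hY : IsCompact Y)
    (μ ν : Measure (EuclideanSpace ℝ (Fin d)))
    [IsProbabilityMeasure μ] [IsProbabilityMeasure ν]
    (hμX : μ Xᶜ = 0) (hνY : ν Yᶜ = 0)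
    (f₀ : EuclideanSpace ℝ (Fin d) → ℝ)
    (T₀ : EuclideanSpace ℝ (Fin d) → EuclideanSpace ℝ (Fin d))
    (hconv : ConvexOn ℝ Set.univ f₀)
    (hgrad₀ : ∀ x, HasGradientAt f₀ (T₀ x) x)
    (hpush : Measure.map T₀ μ = ν)
    (γ M : ℝ) (hγ : 0 < γ) (hγM : γ ≤ M)
    (f : EuclideanSpace ℝ (Fin d) → ℝ)
    (Tf : EuclideanSpace ℝ (Fin d) → EuclideanSpace ℝ (Fin d))
    (hC1 : ContDiff ℝ 1 f)
    (hsc : ConvexOn ℝ Set.univ (fun x => f x - γ / 2 * ‖x‖ ^ 2))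
    (hgradf : ∀ x, HasGradientAt f (Tf x) x)
    (hlip : ∀ a b, ‖Tf a - Tf b‖ ≤ M * ‖a - b‖) :
    ((1 / (2 * M) * ∫ x, ‖Tf x - T₀ x‖ ^ 2 ∂μ : ℝ) : EReal) ≤ Jsd μ ν f - Jsd μ ν f₀ := by
  have hM : 0 < M := hγ.trans_le hγM
  have hT₀ : Measurable T₀ := by
    have : T₀ = fun x => (InnerProductSpace.toDual ℝ _).symm (fderiv ℝ f₀ x) := by
      funext x
      rw [(hgrad₀ x).hasFDerivAt.fderiv]; simp
    rw [this]
    exact (InnerProductSpace.toDual ℝ _).symm.continuous.measurable.comp (measurable_fderiv ℝ f₀)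
  have hf₀c : Continuous f₀ :=
    continuous_iff_continuousAt.2 fun x => (hgrad₀ x).differentiableAt.continuousAt
  have hint : ∀ g : EuclideanSpace ℝ (Fin d) → ℝ, Continuous g → Integrable g μ := by
    intro g hg
    have h1 : IntegrableOn g X μ := hg.continuousOn.integrableOn_compact hX
    rwa [IntegrableOn, Measure.restrict_eq_self_of_ae_mem (ae_iff.2 hμX)] at h1
  have hXae : ∀ᵐ x ∂μ, x ∈ X := ae_iff.2 hμX
  have hYae : ∀ᵐ x ∂μ, T₀ x ∈ Y := by
    have : ∀ᵐ y ∂ν, y ∈ Y := ae_iff.2 hνY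
    rw [← hpush] at this
    exact ae_of_ae_map hT₀.aemeasurable this
  obtain ⟨A, hA⟩ := hX.isBounded.exists_norm_le
  obtain ⟨B, hB⟩ := hY.isBounded.exists_norm_le
  have hinner : Integrable (fun x => ⟪x, T₀ x⟫) μ := by
    refine Integrable.of_bound (C := A * B)
      (measurable_id.inner hT₀).aestronglyMeasurable ?_
    filter_upwards [hXae, hYae] with x h1 h2
    exact (norm_inner_le_norm x (T₀ x)).trans
      (mul_le_mul (hA x h1) (hB _ h2) (norm_nonneg _) ((norm_nonneg _).trans (hA x h1)))
  have hf₀i := hint f₀ hf₀c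
  have hfi := hint f hC1.continuous
  have hcm : ∀ g : EuclideanSpace ℝ (Fin d) → ℝ, Measurable (fun y => (conj g y).toReal) :=
    fun g => conj_measurable.ereal_toReal
  have hmapint : ∀ g : EuclideanSpace ℝ (Fin d) → ℝ,
      ∫ y, (conj g y).toReal ∂ν = ∫ x, (conj g (T₀ x)).toReal ∂μ := by
    intro g
    rw [← hpush, integral_map hT₀.aemeasurable (hcm g).aestronglyMeasurable]
  have hJ₀ : Jsd μ ν f₀ = ((∫ x, ⟪x, T₀ x⟫ ∂μ : ℝ) : EReal) := by
    have hcond : (∀ᵐ y ∂ν, conj f₀ y ≠ ⊤) ∧ Integrable (fun y => (conj f₀ y).toReal) ν := by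
      constructor
      · rw [← hpush, ae_map_iff hT₀.aemeasurable
          (show MeasurableSet {y | conj f₀ y ≠ ⊤} from
            conj_measurable (measurableSet_singleton ⊤).compl)]
        refine Filter.Eventually.of_forall fun x => ?_
        rw [conj_grad hconv hgrad₀ x]
        exact EReal.coe_ne_top _
      · rw [← hpush, integrable_map_measure (hcm f₀).aestronglyMeasurable hT₀.aemeasurable]
        refine (hinner.sub hf₀i).congr (Filter.Eventually.of_forall fun x => ?_)
        simp only [Function.comp, conj_grad hconv hgrad₀ x, EReal.toReal_coe, Pi.sub_apply]
    rw [Jsd, eintegral, if_pos hcond, hmapint, ← EReal.coe_add]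
    simp only [conj_grad hconv hgrad₀, EReal.toReal_coe]
    rw [integral_sub hinner hf₀i]
    congr 1
    ring
  rw [hJ₀, Jsd, eintegral]
  split_ifs with hcond
  · obtain ⟨hfin, hci⟩ := hcond
    rw [← EReal.coe_add, ← EReal.coe_sub, EReal.coe_le_coe_iff, hmapint]
    rw [← hpush, integrable_map_measure (hcm f).aestronglyMeasurable hT₀.aemeasurable] at hci
    rw [← hpush] at hfin
    have hfin' := ae_of_ae_map hT₀.aemeasurable hfin
    have hci' : Integrable (fun x => (conj f (T₀ x)).toReal) μ := hci
    have hsum : Integrable (fun x => f x + (conj f (T₀ x)).toReal) μ := hfi.add hci'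
    rw [← integral_add hfi hci', ← integral_sub hsum hinner, ← integral_const_mul]
    refine integral_mono_of_nonneg (Filter.Eventually.of_forall fun x => ?_)
      (hsum.sub hinner) ?_
    · simp only [Pi.zero_apply]; positivity
    · filter_upwards [hfin'] with x hx
      have h1 := conj_lower hgradf hM hlip x (T₀ x)
      have h2 : conj f (T₀ x) ≠ ⊥ := fun h => by
        rw [h] at h1
        exact EReal.coe_ne_bot _ (le_bot_iff.1 h1)
      rw [← EReal.coe_toReal hx h2, EReal.coe_le_coe_iff] at h1
      show _ ≤ f x + (conj f (T₀ x)).toReal - ⟪x, T₀ x⟫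
      linarith
  · rw [EReal.coe_add_top, EReal.top_sub_coe]
    exact le_top
end

section
/- Let μ and ν be probability measures on compact subsets X and Y of ℝ^d, and assume there exists a convex differentiable function f₀ : ℝ^d → ℝ with (∇f₀)_#μ = ν; set T₀ = ∇f₀ and e_μ(f) = ∫ ‖∇f(x) − T₀(x)‖² dμ(x). Let f₁, …, f_p : ℝ^d → ℝ each be C¹, γ-strongly convex with M-Lipschitz gradient (0 < γ ≤ M). If i₀ minimizes i ↦ J_{μ,ν}(f_i) over {1,…,p} and i₁ minimizes i ↦ e_μ(f_i), then e_μ(f_{i₀}) ≤ (M/γ) e_μ(f_{i₁}). -/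
open MeasureTheory
open scoped RealInnerProductSpace

lemma line_deriv {d : ℕ} (f : (EuclideanSpace ℝ (Fin d)) → ℝ) (x v g : EuclideanSpace ℝ (Fin d)) (t : ℝ)
    (h : HasGradientAt f g (x + t • v)) :
    HasDerivAt (fun s : ℝ => f (x + s • v)) ⟪g, v⟫ t := by
  have h1 : HasDerivAt (fun s : ℝ => x + s • v) v t := by
    simpa using ((hasDerivAt_id t).smul_const v).const_add x
  have h2 := h.hasFDerivAt.comp_hasDerivAt t h1
  exact HasDerivAt.congr_deriv h2 (by simp)

lemma sc_lower {d : ℕ} (f : (EuclideanSpace ℝ (Fin d)) → ℝ) (T : (EuclideanSpace ℝ (Fin d)) → (EuclideanSpace ℝ (Fin d))) (γ : ℝ)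
    (hsc : ConvexOn ℝ Set.univ (fun x => f x - γ / 2 * ‖x‖ ^ 2))
    (hg : ∀ x, HasGradientAt f (T x) x) (x v : EuclideanSpace ℝ (Fin d)) :
    f x + ⟪T x, v⟫ + γ / 2 * ‖v‖ ^ 2 ≤ f (x + v) := by
  have key : ∀ s : ℝ, ‖x + s • v‖ ^ 2 = ‖x‖ ^ 2 + 2 * s * ⟪x, v⟫ + s ^ 2 * ‖v‖ ^ 2 := by
    intro s
    rw [norm_add_sq_real, inner_smul_right, norm_smul, mul_pow, Real.norm_eq_abs, sq_abs]; ring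
  have hc : ConvexOn ℝ Set.univ (fun s : ℝ => f (x + s • v) - γ / 2 * ‖x + s • v‖ ^ 2) := by
    have := hsc.comp_affineMap (AffineMap.lineMap x (x + v) : ℝ →ᵃ[ℝ] (EuclideanSpace ℝ (Fin d)))
    have e : (fun s : ℝ => f (x + s • v) - γ / 2 * ‖x + s • v‖ ^ 2) =
        (fun x => f x - γ / 2 * ‖x‖ ^ 2) ∘ (AffineMap.lineMap x (x + v) : ℝ →ᵃ[ℝ] (EuclideanSpace ℝ (Fin d))) := by
      funext s
      simp [AffineMap.lineMap_apply, add_comm]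
    rw [e]
    simpa using this
  have hd : HasDerivAt (fun s : ℝ => f (x + s • v) - γ / 2 * ‖x + s • v‖ ^ 2)
      (⟪T x, v⟫ - γ / 2 * (2 * ⟪x, v⟫)) 0 := by
    refine HasDerivAt.sub (line_deriv f x v (T x) 0 (by simpa using hg x)) ?_
    refine HasDerivAt.const_mul _ ?_
    simp_rw [key]
    have h1 := (((hasDerivAt_id (0:ℝ)).const_mul 2).mul_const ⟪x, v⟫).const_add (‖x‖ ^ 2)
    have h2 := ((hasDerivAt_id (0:ℝ)).pow 2).mul_const (‖v‖ ^ 2)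
    exact HasDerivAt.congr_deriv (h1.add h2) (by simp)
  have := hc.le_slope_of_hasDerivAt (Set.mem_univ 0) (Set.mem_univ 1) one_pos hd
  simp only [slope_def_field, key] at this
  norm_num at this
  linarith

lemma smooth_upper {d : ℕ} (f : (EuclideanSpace ℝ (Fin d)) → ℝ) (T : (EuclideanSpace ℝ (Fin d)) → (EuclideanSpace ℝ (Fin d))) (M : ℝ)
    (hg : ∀ x, HasGradientAt f (T x) x)
    (hlip : ∀ a b, ‖T a - T b‖ ≤ M * ‖a - b‖) (x v : EuclideanSpace ℝ (Fin d)) :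
    f (x + v) ≤ f x + ⟪T x, v⟫ + M / 2 * ‖v‖ ^ 2 := by
  have hd : ∀ t : ℝ, HasDerivAt
      (fun s : ℝ => f (x + s • v) - s * ⟪T x, v⟫ - s ^ 2 * (M / 2 * ‖v‖ ^ 2))
      (⟪T (x + t • v), v⟫ - ⟪T x, v⟫ - 2 * t * (M / 2 * ‖v‖ ^ 2)) t := by
    intro t
    have h1 := (hasDerivAt_id t).mul_const ⟪T x, v⟫
    have h2 := ((hasDerivAt_id t).pow 2).mul_const (M / 2 * ‖v‖ ^ 2)
    exact HasDerivAt.congr_deriv (((line_deriv f x v _ t (hg _)).sub h1).sub h2) (by simp)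
  have ha : AntitoneOn
      (fun s : ℝ => f (x + s • v) - s * ⟪T x, v⟫ - s ^ 2 * (M / 2 * ‖v‖ ^ 2)) (Set.Ici 0) := by
    refine antitoneOn_of_deriv_nonpos (convex_Ici 0)
      (fun t _ => (hd t).continuousAt.continuousWithinAt)
      (fun t _ => (hd t).differentiableAt.differentiableWithinAt) ?_
    intro t ht
    rw [interior_Ici] at ht
    have ht : 0 < t := ht
    rw [(hd t).deriv, ← inner_sub_left]
    have h1 := real_inner_le_norm (T (x + t • v) - T x) v
    have h2 := hlip (x + t • v) x
    rw [add_sub_cancel_left, norm_smul, Real.norm_eq_abs, abs_of_pos ht] at h2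
    have h3 := mul_le_mul_of_nonneg_right h2 (norm_nonneg v)
    nlinarith
  have := ha (Set.mem_Ici.2 le_rfl) (Set.mem_Ici.2 zero_le_one) zero_le_one
  norm_num at this
  linarith

lemma conj_bounds {d : ℕ} (f : (EuclideanSpace ℝ (Fin d)) → ℝ) (T : (EuclideanSpace ℝ (Fin d)) → (EuclideanSpace ℝ (Fin d))) (γ M : ℝ) (hγ : 0 < γ) (hM : 0 < M)
    (hsc : ConvexOn ℝ Set.univ (fun x => f x - γ / 2 * ‖x‖ ^ 2))
    (hg : ∀ x, HasGradientAt f (T x) x)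
    (hlip : ∀ a b, ‖T a - T b‖ ≤ M * ‖a - b‖) (x y : EuclideanSpace ℝ (Fin d)) :
    conj f y ≠ ⊤ ∧
    1 / (2 * M) * ‖T x - y‖ ^ 2 ≤ f x + (conj f y).toReal - ⟪x, y⟫ ∧
    f x + (conj f y).toReal - ⟪x, y⟫ ≤ 1 / (2 * γ) * ‖T x - y‖ ^ 2 := by
  have hu : conj f y ≤ ((⟪x, y⟫ - f x + 1 / (2 * γ) * ‖T x - y‖ ^ 2 : ℝ) : EReal) := by
    refine iSup_le fun z => ?_
    rw [EReal.coe_le_coe_iff]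
    have h := sc_lower f T γ hsc hg x (z - x)
    rw [add_sub_cancel] at h
    have h1 : ⟪z, y⟫ = ⟪x, y⟫ + ⟪y, z - x⟫ := by
      rw [real_inner_comm, ← real_inner_comm x y, ← inner_add_right]; simp
    have h2 : ⟪T x - y, z - x⟫ = ⟪T x, z - x⟫ - ⟪y, z - x⟫ := inner_sub_left _ _ _
    have h3 : 0 ≤ ‖(T x - y) + γ • (z - x)‖ ^ 2 := by positivity
    rw [norm_add_sq_real, inner_smul_right, norm_smul, mul_pow, Real.norm_eq_abs, sq_abs] at h3
    have h4 : 0 ≤ 1 / (2 * γ) * (‖T x - y‖ ^ 2 + 2 * (γ * ⟪T x - y, z - x⟫)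
      + γ ^ 2 * ‖z - x‖ ^ 2) := by positivity
    have h5 : 1 / (2 * γ) * (‖T x - y‖ ^ 2 + 2 * (γ * ⟪T x - y, z - x⟫)
      + γ ^ 2 * ‖z - x‖ ^ 2) = 1 / (2 * γ) * ‖T x - y‖ ^ 2 + ⟪T x - y, z - x⟫
        + γ / 2 * ‖z - x‖ ^ 2 := by field_simp
    linarith
  have hl : ((⟪x, y⟫ - f x + 1 / (2 * M) * ‖T x - y‖ ^ 2 : ℝ) : EReal) ≤ conj f y := by
    refine le_trans ?_ (le_iSup (fun x => ((⟪x, y⟫ - f x : ℝ) : EReal)) (x + (1 / M) • (y - T x)))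
    rw [EReal.coe_le_coe_iff]
    have h := smooth_upper f T M hg hlip x ((1 / M) • (y - T x))
    have e : ‖T x - y‖ = ‖y - T x‖ := norm_sub_rev _ _
    have h2 : ⟪y, y - T x⟫ - ⟪T x, y - T x⟫ = ‖y - T x‖ ^ 2 := by
      rw [← inner_sub_left, real_inner_self_eq_norm_sq]
    rw [inner_smul_right, norm_smul, mul_pow, Real.norm_eq_abs, sq_abs] at h
    rw [inner_add_left, inner_smul_left, real_inner_comm y (y - T x), e]
    have h3 : ⟪y, y - T x⟫ = ⟪T x, y - T x⟫ + ‖y - T x‖ ^ 2 := by linarith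
    simp only [conj_trivial]
    rw [h3]
    have h4 : M / 2 * ((1 / M) ^ 2 * ‖y - T x‖ ^ 2) = 1 / (2 * M) * ‖y - T x‖ ^ 2 := by
      field_simp
    have h5 : 1 / M * ‖y - T x‖ ^ 2 = 2 * (1 / (2 * M) * ‖y - T x‖ ^ 2) := by
      field_simp
    linarith
  have ht : conj f y ≠ ⊤ := ne_top_of_le_ne_top (EReal.coe_ne_top _) hu
  have hb : conj f y ≠ ⊥ := ne_bot_of_le_ne_bot (EReal.coe_ne_bot _) hl
  rw [← EReal.coe_toReal ht hb, EReal.coe_le_coe_iff] at hu hl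
  exact ⟨ht, by linarith, by linarith⟩

lemma conj_meas {d : ℕ} (f : (EuclideanSpace ℝ (Fin d)) → ℝ) : Measurable (conj f) := by
  apply LowerSemicontinuous.measurable
  unfold conj
  apply lowerSemicontinuous_iSup
  intro x
  apply Continuous.lowerSemicontinuous
  exact continuous_coe_real_ereal.comp (by fun_prop)

lemma J_bounds {d : ℕ} (X Y : Set (EuclideanSpace ℝ (Fin d)))
    (hX : IsCompact X) (hY : IsCompact Y) (μ ν : Measure (EuclideanSpace ℝ (Fin d)))
    [IsProbabilityMeasure μ] [IsProbabilityMeasure ν]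
    (hμX : μ Xᶜ = 0) (hνY : ν Yᶜ = 0) (T₀ : (EuclideanSpace ℝ (Fin d)) → (EuclideanSpace ℝ (Fin d)))
    (hpush : Measure.map T₀ μ = ν)
    (f : (EuclideanSpace ℝ (Fin d)) → ℝ) (T : (EuclideanSpace ℝ (Fin d)) → (EuclideanSpace ℝ (Fin d))) (γ M : ℝ) (hγ : 0 < γ) (hM : 0 < M)
    (hsc : ConvexOn ℝ Set.univ (fun x => f x - γ / 2 * ‖x‖ ^ 2))
    (hg : ∀ x, HasGradientAt f (T x) x)
    (hlip : ∀ a b, ‖T a - T b‖ ≤ M * ‖a - b‖) :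
    ∃ J : ℝ, Jsd μ ν f = (J : EReal) ∧
      1 / (2 * M) * ∫ x, ‖T x - T₀ x‖ ^ 2 ∂μ ≤ J - ∫ x, ⟪x, T₀ x⟫ ∂μ ∧
      J - ∫ x, ⟪x, T₀ x⟫ ∂μ ≤ 1 / (2 * γ) * ∫ x, ‖T x - T₀ x‖ ^ 2 ∂μ := by
  have hT₀ : AEMeasurable T₀ μ := by
    apply AEMeasurable.of_map_ne_zero
    rw [hpush]; exact IsProbabilityMeasure.ne_zero ν
  have hTc : Continuous T := by
    have : LipschitzWith ⟨M, hM.le⟩ T := LipschitzWith.of_dist_le_mul fun a b => by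
      rw [dist_eq_norm, dist_eq_norm]; exact hlip a b
    exact this.continuous
  have hfc : Continuous f := continuous_iff_continuousAt.2 fun x =>
    (hg x).hasFDerivAt.continuousAt
  have haX : ∀ᵐ x ∂μ, x ∈ X := by rw [ae_iff]; exact hμX
  have haY : ∀ᵐ x ∂μ, T₀ x ∈ Y := by
    have : ∀ᵐ y ∂ν, y ∈ Y := by rw [ae_iff]; exact hνY
    rw [← hpush] at this
    exact ae_of_ae_map hT₀ this
  have hT₀m : AEStronglyMeasurable T₀ μ := hT₀.aestronglyMeasurable
  obtain ⟨CY, hCY⟩ := hY.isBounded.exists_norm_le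
  obtain ⟨CX, hCX⟩ := hX.isBounded.exists_norm_le
  obtain ⟨CT, hCT⟩ := hX.exists_bound_of_continuousOn hTc.continuousOn
  obtain ⟨Cf, hCf⟩ := hX.exists_bound_of_continuousOn hfc.continuousOn
  have hfi : Integrable f μ := by
    refine Integrable.of_bound hfc.aestronglyMeasurable Cf ?_
    filter_upwards [haX] with x hx using hCf x hx
  have ie : Integrable (fun x => ‖T x - T₀ x‖ ^ 2) μ := by
    refine Integrable.of_bound
      ((hTc.aestronglyMeasurable.sub hT₀m).norm.pow 2) ((CT + CY) ^ 2) ?_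
    filter_upwards [haX, haY] with x hx hy
    rw [Real.norm_eq_abs, abs_of_nonneg (by positivity)]
    have := norm_sub_le (T x) (T₀ x)
    have h1 := hCT x hx
    have h2 := hCY _ hy
    gcongr
    linarith
  have ii : Integrable (fun x => ⟪x, T₀ x⟫) μ := by
    refine Integrable.of_bound
      (continuous_id.aestronglyMeasurable.inner hT₀m) (CX * CY) ?_
    filter_upwards [haX, haY] with x hx hy
    have h1 := hCX x hx
    have h2 := hCY _ hy
    refine (norm_inner_le_norm _ _).trans ?_
    have := norm_nonneg x
    gcongr
    linarith
  have hb := fun x => conj_bounds f T γ M hγ hM hsc hg hlip x (T₀ x)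
  have hcm : Measurable fun y => (conj f y).toReal := (conj_meas f).ereal_toReal
  have ig : Integrable (fun x => f x + (conj f (T₀ x)).toReal - ⟪x, T₀ x⟫) μ := by
    refine Integrable.mono' (ie.const_mul (1 / (2 * γ))) ?_ ?_
    · exact (hfi.1.add (hcm.comp_aemeasurable hT₀).aestronglyMeasurable).sub ii.1
    · refine Filter.Eventually.of_forall fun x => ?_
      obtain ⟨-, h1, h2⟩ := hb x
      rw [Real.norm_eq_abs, abs_of_nonneg (le_trans (by positivity) h1)]
      exact h2
  have ic : Integrable (fun x => (conj f (T₀ x)).toReal) μ := by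
    refine ((ig.add ii).sub hfi).congr (Filter.Eventually.of_forall fun x => ?_)
    simp
  have icν : Integrable (fun y => (conj f y).toReal) ν := by
    rw [← hpush, integrable_map_measure hcm.aestronglyMeasurable hT₀]; exact ic
  have hint : ∫ x, (f x + (conj f (T₀ x)).toReal - ⟪x, T₀ x⟫) ∂μ =
      (∫ x, f x ∂μ + ∫ y, (conj f y).toReal ∂ν) - ∫ x, ⟪x, T₀ x⟫ ∂μ := by
    have iadd : Integrable (fun x => f x + (conj f (T₀ x)).toReal) μ := hfi.add ic
    rw [integral_sub iadd ii, integral_add hfi ic, ← hpush,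
      integral_map hT₀ hcm.aestronglyMeasurable]
  refine ⟨∫ x, f x ∂μ + ∫ y, (conj f y).toReal ∂ν, ?_, ?_, ?_⟩
  · unfold Jsd eintegral
    rw [if_pos ⟨Filter.Eventually.of_forall fun y =>
      (conj_bounds f T γ M hγ hM hsc hg hlip 0 y).1, icν⟩, EReal.coe_add]
  · rw [← hint, ← integral_const_mul]
    exact integral_mono (ie.const_mul _) ig fun x => (hb x).2.1
  · rw [← hint, ← integral_const_mul]
    exact integral_mono ig (ie.const_mul _) fun x => (hb x).2.2

/-- if `i₀` minimizes `i ↦ J_{μ,ν}(f i)` and `i₁` minimizes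
`i ↦ e_μ(f i) = ∫ ‖∇(f i) - T₀‖² dμ`, then `e_μ(f i₀) ≤ (M/γ) e_μ(f i₁)`. -/
theorem stmt_6 {d p : ℕ} (X Y : Set (EuclideanSpace ℝ (Fin d)))
    (hX : IsCompact X) (hY : IsCompact Y)
    (μ ν : Measure (EuclideanSpace ℝ (Fin d)))
    [IsProbabilityMeasure μ] [IsProbabilityMeasure ν]
    (hμX : μ Xᶜ = 0) (hνY : ν Yᶜ = 0)
    (f₀ : EuclideanSpace ℝ (Fin d) → ℝ)
    (T₀ : EuclideanSpace ℝ (Fin d) → EuclideanSpace ℝ (Fin d))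
    (hconv : ConvexOn ℝ Set.univ f₀)
    (hgrad₀ : ∀ x, HasGradientAt f₀ (T₀ x) x)
    (hpush : Measure.map T₀ μ = ν)
    (γ M : ℝ) (hγ : 0 < γ) (hγM : γ ≤ M)
    (f : Fin p → EuclideanSpace ℝ (Fin d) → ℝ)
    (Tf : Fin p → EuclideanSpace ℝ (Fin d) → EuclideanSpace ℝ (Fin d))
    (hC1 : ∀ i, ContDiff ℝ 1 (f i))
    (hsc : ∀ i, ConvexOn ℝ Set.univ (fun x => f i x - γ / 2 * ‖x‖ ^ 2))
    (hgradf : ∀ i x, HasGradientAt (f i) (Tf i x) x)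
    (hlip : ∀ i a b, ‖Tf i a - Tf i b‖ ≤ M * ‖a - b‖)
    (i₀ i₁ : Fin p)
    (hi₀ : ∀ j, Jsd μ ν (f i₀) ≤ Jsd μ ν (f j))
    (hi₁ : ∀ j, ∫ x, ‖Tf i₁ x - T₀ x‖ ^ 2 ∂μ ≤ ∫ x, ‖Tf j x - T₀ x‖ ^ 2 ∂μ) :
    ∫ x, ‖Tf i₀ x - T₀ x‖ ^ 2 ∂μ ≤ M / γ * ∫ x, ‖Tf i₁ x - T₀ x‖ ^ 2 ∂μ := by
  have hM : 0 < M := hγ.trans_le hγM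
  obtain ⟨J0, e0, h0, -⟩ := J_bounds X Y hX hY μ ν hμX hνY T₀ hpush (f i₀) (Tf i₀) γ M hγ hM
    (hsc i₀) (hgradf i₀) (hlip i₀)
  obtain ⟨J1, e1, -, h1⟩ := J_bounds X Y hX hY μ ν hμX hνY T₀ hpush (f i₁) (Tf i₁) γ M hγ hM
    (hsc i₁) (hgradf i₁) (hlip i₁)
  have h := hi₀ i₁
  rw [e0, e1, EReal.coe_le_coe_iff] at h
  have h2 := h0.trans ((sub_le_sub_right h _).trans h1)
  have h3 := mul_le_mul_of_nonneg_left h2 (by positivity : 0 ≤ 2 * M)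
  have h4 : ∀ a : ℝ, 2 * M * (1 / (2 * M) * a) = a := fun a => by field_simp
  have h5 : ∀ a : ℝ, 2 * M * (1 / (2 * γ) * a) = M / γ * a := fun a => by field_simp
  rwa [h4, h5] at h3
end

section
/- Let 0 < γ < M and define f : ℝ → ℝ by f(x) = (γ/2)x² for x ≤ 0 and f(x) = (M/2)x² for x > 0. Then f is differentiable, γ-strongly convex and has M-Lipschitz derivative; moreover, setting x₀(ε) = −1/√γ + ε and x₁(ε) = 1/√M + ε, one has f(x₀(ε)) < f(x₁(ε)) for all sufficiently small ε > 0, while lim_{ε → 0⁺} x₀(ε)² / x₁(ε)² = M/γ. (Hence the distortion factor M/γ in semi-dual potential selection is sharp.) -/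
/-- the distortion factor `M/γ` is sharp: the piecewise-quadratic function
`f(x) = (γ/2)x²` for `x ≤ 0`, `f(x) = (M/2)x²` for `x > 0` is differentiable, `γ`-strongly
convex with `M`-Lipschitz derivative, satisfies `f(x₀ ε) < f(x₁ ε)` for all small `ε > 0`
where `x₀ ε = -1/√γ + ε` and `x₁ ε = 1/√M + ε`, and yet `x₀(ε)²/x₁(ε)² → M/γ` as `ε → 0⁺`. -/
theorem stmt_7 (γ M : ℝ) (hγ : 0 < γ) (hγM : γ < M)
    (f : ℝ → ℝ)
    (hf : ∀ x, f x = if x ≤ 0 then γ / 2 * x ^ 2 else M / 2 * x ^ 2) :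
    Differentiable ℝ f ∧
    ConvexOn ℝ Set.univ (fun x => f x - γ / 2 * x ^ 2) ∧
    (∀ x y, |deriv f x - deriv f y| ≤ M * |x - y|) ∧
    (∃ ε₀ > 0, ∀ ε, 0 < ε → ε < ε₀ →
      f (-1 / Real.sqrt γ + ε) < f (1 / Real.sqrt M + ε)) ∧
    Filter.Tendsto (fun ε => (-1 / Real.sqrt γ + ε) ^ 2 / (1 / Real.sqrt M + ε) ^ 2)
      (nhdsWithin 0 (Set.Ioi 0)) (nhds (M / γ)) := by
  have hM : 0 < M := hγ.trans hγM
  have hq : ∀ c x : ℝ, HasDerivAt (fun x : ℝ => c / 2 * x ^ 2) (c * x) x := by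
    intro c x
    have h := (hasDerivAt_pow 2 x).const_mul (c / 2)
    have e : c / 2 * (((2 : ℕ) : ℝ) * x ^ (2 - 1)) = c * x := by
      norm_num
      ring
    rwa [e] at h
  have hd : ∀ x, HasDerivAt f (if x ≤ 0 then γ * x else M * x) x := by
    intro x
    rcases lt_trichotomy x 0 with h | h | h
    · rw [if_pos h.le]
      refine (hq γ x).congr_of_eventuallyEq ?_
      filter_upwards [Iio_mem_nhds h] with y hy
      rw [hf, if_pos (le_of_lt hy)]
    · subst h
      have h1 : HasDerivWithinAt f 0 (Set.Iic 0) 0 := by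
        have h := (hq γ 0).hasDerivWithinAt (s := Set.Iic 0)
        rw [mul_zero] at h
        refine h.congr (fun y hy => ?_) ?_
        · rw [hf, if_pos (Set.mem_Iic.mp hy)]
        · rw [hf, if_pos le_rfl]
      have h2 : HasDerivWithinAt f 0 (Set.Ici 0) 0 := by
        have h := (hq M 0).hasDerivWithinAt (s := Set.Ici 0)
        rw [mul_zero] at h
        refine h.congr (fun y hy => ?_) ?_
        · rcases eq_or_lt_of_le (show (0:ℝ) ≤ y from hy) with h0 | h0
          · rw [← h0, hf]; simp
          · rw [hf, if_neg (not_le.mpr h0)]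
        · rw [hf]; simp
      have h3 := h1.union h2
      rw [Set.Iic_union_Ici, hasDerivWithinAt_univ] at h3
      simpa using h3
    · rw [if_neg (not_le.mpr h)]
      refine (hq M x).congr_of_eventuallyEq ?_
      filter_upwards [Ioi_mem_nhds h] with y hy
      rw [hf, if_neg (not_le.mpr hy)]
  have hfd : Differentiable ℝ f := fun x => (hd x).differentiableAt
  refine ⟨hfd, ?_, ?_, ?_, ?_⟩
  · have hg : ∀ x, HasDerivAt (fun x => f x - γ / 2 * x ^ 2)
        ((if x ≤ 0 then γ * x else M * x) - γ * x) x := fun x => (hd x).sub (hq γ x)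
    refine Monotone.convexOn_univ_of_deriv (fun x => (hg x).differentiableAt) ?_
    intro x y hxy
    rw [(hg x).deriv, (hg y).deriv]
    split_ifs with h1 h2 h2
    · linarith
    · push Not at h2
      nlinarith
    · linarith
    · nlinarith
  · have key : ∀ x y, x ≤ y → |deriv f x - deriv f y| ≤ M * |x - y| := by
      intro x y hxy
      rw [(hd x).deriv, (hd y).deriv, abs_of_nonpos (sub_nonpos.mpr hxy), abs_le]
      split_ifs with h1 h2 h2 <;> constructor <;> nlinarith
    intro x y
    rcases le_total x y with h | h
    · exact key x y h
    · rw [abs_sub_comm, abs_sub_comm x y]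
      exact key y x h
  · have ha : 0 < 1 / Real.sqrt γ := by positivity
    have hb : 0 < 1 / Real.sqrt M := by positivity
    have ha2 : γ * (1 / Real.sqrt γ) ^ 2 = 1 := by
      rw [div_pow, Real.sq_sqrt hγ.le]; field_simp
    have hb2 : M * (1 / Real.sqrt M) ^ 2 = 1 := by
      rw [div_pow, Real.sq_sqrt hM.le]; field_simp
    refine ⟨1 / Real.sqrt γ, ha, fun ε h0 h1 => ?_⟩
    rw [neg_div]
    generalize 1 / Real.sqrt γ = a at *
    generalize 1 / Real.sqrt M = b at *
    rw [hf, hf, if_pos (by linarith), if_neg (by linarith)]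
    have e1 : (-a + ε) ^ 2 < a ^ 2 := by nlinarith
    have e2 : b ^ 2 < (b + ε) ^ 2 := by nlinarith
    have := mul_lt_mul_of_pos_left e1 hγ
    have := mul_lt_mul_of_pos_left e2 hM
    linarith
  · have hb : 1 / Real.sqrt M + 0 ≠ 0 := by
      have : 0 < 1 / Real.sqrt M := by positivity
      linarith
    have hc : ContinuousAt
        (fun ε : ℝ => (-1 / Real.sqrt γ + ε) ^ 2 / (1 / Real.sqrt M + ε) ^ 2) 0 := by
      refine ContinuousAt.div (by fun_prop) (by fun_prop) (pow_ne_zero 2 hb)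
    have h := hc.tendsto.mono_left (nhdsWithin_le_nhds (s := Set.Ioi 0))
    convert h using 2
    rw [add_zero, add_zero, div_pow, div_pow, Real.sq_sqrt hγ.le, Real.sq_sqrt hM.le]
    field_simp
    try norm_num
end

section
/- Fix b ∈ ℝ^n and a matrix C ∈ ℝ^{n×d} with rows c₁, …, c_n ∈ ℝ^d, and define f : ℝ^d → ℝ by f(x) = log( Σ_{i=1}^n e^{⟨c_i, x⟩ + b_i} ). Then for every y ∈ ℝ^d, f*(y) = inf { Σ_{i=1}^n Δ_i log Δ_i − ⟨b, Δ⟩ : Δ ∈ Δ_n, Σ_{i=1}^n Δ_i c_i = y }, where the infimum over the empty set is +∞ (with the convention 0·log 0 = 0). -/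
open MeasureTheory
open scoped RealInnerProductSpace

lemma gibbs_aux {n : ℕ} (hn : 0 < n) (s D : Fin n → ℝ) (h0 : ∀ i, 0 ≤ D i)
    (h1 : ∑ i, D i = 1) :
    ∑ i, D i * s i - ∑ i, D i * Real.log (D i) ≤ Real.log (∑ i, Real.exp (s i)) := by
  have : Nonempty (Fin n) := ⟨⟨0, hn⟩⟩
  set S := ∑ i, Real.exp (s i) with hS
  have hSpos : 0 < S := Finset.sum_pos (fun i _ => Real.exp_pos _) Finset.univ_nonempty
  have key : ∀ i, D i * s i - D i * Real.log (D i) - D i * Real.log S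
      ≤ Real.exp (s i) / S - D i := by
    intro i
    rcases (h0 i).eq_or_lt with h | h
    · rw [← h]
      have : 0 ≤ Real.exp (s i) / S := by positivity
      simpa using this
    · have h2 := Real.add_one_le_exp (s i - Real.log S - Real.log (D i))
      rw [Real.exp_sub, Real.exp_sub, Real.exp_log hSpos, Real.exp_log h, le_div_iff₀ h] at h2
      linarith
  have hsum := Finset.sum_le_sum (fun i (_ : i ∈ Finset.univ) => key i)
  simp only [Finset.sum_sub_distrib, ← Finset.sum_mul, ← Finset.sum_div, h1] at hsum
  rw [← hS, div_self hSpos.ne'] at hsum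
  linarith

lemma gibbs_eq_aux {n : ℕ} (hn : 0 < n) (s : Fin n → ℝ) :
    ∃ D ∈ stdSimplex ℝ (Fin n),
    ∑ i, D i * s i - ∑ i, D i * Real.log (D i) = Real.log (∑ i, Real.exp (s i)) := by
  have : Nonempty (Fin n) := ⟨⟨0, hn⟩⟩
  set S := ∑ i, Real.exp (s i) with hS
  have hSpos : 0 < S := Finset.sum_pos (fun i _ => Real.exp_pos _) Finset.univ_nonempty
  have h1 : ∑ i, Real.exp (s i) / S = 1 := by
    rw [← Finset.sum_div, ← hS, div_self hSpos.ne']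
  refine ⟨fun i => Real.exp (s i) / S, ⟨fun i => by positivity, h1⟩, ?_⟩
  rw [← Finset.sum_sub_distrib]
  have : ∀ i, Real.exp (s i) / S * s i - Real.exp (s i) / S * Real.log (Real.exp (s i) / S)
      = Real.exp (s i) / S * Real.log S := by
    intro i
    rw [Real.log_div (Real.exp_pos _).ne' hSpos.ne', Real.log_exp]
    ring
  simp only [this]
  rw [← Finset.sum_mul, h1, one_mul]

/-- for `f(x) = log(Σᵢ exp(⟪cᵢ, x⟫ + bᵢ))`, the conjugate is
`f*(y) = inf { Σᵢ Δᵢ log Δᵢ - ⟪b, Δ⟫ : Δ ∈ Δₙ, Σᵢ Δᵢ cᵢ = y }`,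
the infimum over the empty set being `+∞`. -/
theorem stmt_10 {n d : ℕ} (hn : 0 < n) (b : Fin n → ℝ)
    (c : Fin n → EuclideanSpace ℝ (Fin d)) (y : EuclideanSpace ℝ (Fin d)) :
    conj (fun x => Real.log (∑ i, Real.exp (⟪c i, x⟫ + b i))) y
      = ⨅ Δ ∈ {Δ : Fin n → ℝ |
            (∀ i, 0 ≤ Δ i) ∧ ∑ i, Δ i = 1 ∧ ∑ i, Δ i • c i = y},
          ((∑ i, Δ i * Real.log (Δ i) - ∑ i, b i * Δ i : ℝ) : EReal) := by
  have hin : ∀ (x : EuclideanSpace ℝ (Fin d)) (D : Fin n → ℝ),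
      ⟪x, ∑ i, D i • c i⟫ = ∑ i, D i * ⟪c i, x⟫ := by
    intro x D
    rw [inner_sum]
    exact Finset.sum_congr rfl fun i _ => by rw [real_inner_smul_right, real_inner_comm]
  have hsp : ∀ (x : EuclideanSpace ℝ (Fin d)) (D : Fin n → ℝ),
      ∑ i, D i * (⟪c i, x⟫ + b i) = ∑ i, D i * ⟪c i, x⟫ + ∑ i, b i * D i := by
    intro x D
    rw [← Finset.sum_add_distrib]
    exact Finset.sum_congr rfl fun i _ => by ring
  unfold conj
  apply le_antisymm
  · refine iSup_le fun x => le_iInf₂ fun D hD => ?_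
    obtain ⟨h0, h1, h2⟩ := hD
    have hg := gibbs_aux hn (fun i => ⟪c i, x⟫ + b i) D h0 h1
    rw [hsp, ← hin, h2] at hg
    exact EReal.coe_le_coe_iff.2 (by linarith)
  · let G : (Fin n → ℝ) → EuclideanSpace ℝ (Fin d) → ℝ := fun D x =>
      (∑ i, D i * Real.log (D i) - ∑ i, b i * D i) + (⟪x, y⟫ - ∑ i, D i * ⟪c i, x⟫)
    have : Nonempty (Fin n) := ⟨⟨0, hn⟩⟩
    have hmm : (⨅ D ∈ stdSimplex ℝ (Fin n),
          ⨆ x ∈ (Set.univ : Set (EuclideanSpace ℝ (Fin d))), ((G D x : ℝ) : EReal))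
        = ⨆ x ∈ (Set.univ : Set (EuclideanSpace ℝ (Fin d))),
          ⨅ D ∈ stdSimplex ℝ (Fin n), ((G D x : ℝ) : EReal) := by
      have hmono : Monotone (Real.toEReal) := fun a b h => EReal.coe_le_coe_iff.2 h
      apply Sion.minimax'
      · exact ⟨_, single_mem_stdSimplex ℝ (⟨0, hn⟩ : Fin n)⟩
      · exact convex_stdSimplex ℝ _
      · exact isCompact_stdSimplex ℝ _
      · intro x _
        refine ContinuousOn.lowerSemicontinuousOn (Continuous.continuousOn ?_)
        apply continuous_coe_real_ereal.comp
        have : ∀ i, Continuous fun D : Fin n → ℝ => D i * Real.log (D i) := fun i =>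
          Real.continuous_mul_log.comp (continuous_apply i)
        fun_prop
      · intro x _
        have hc : ConvexOn ℝ (stdSimplex ℝ (Fin n)) (fun D => G D x) := by
          refine ⟨convex_stdSimplex ℝ _, ?_⟩
          intro D hD D' hD' p q hp hq hpq
          have hlog : ∑ i, (p * D i + q * D' i) * Real.log (p * D i + q * D' i)
              ≤ ∑ i, (p * (D i * Real.log (D i)) + q * (D' i * Real.log (D' i))) :=
            Finset.sum_le_sum fun i _ =>
              Real.convexOn_mul_log.2 (hD.1 i) (hD'.1 i) hp hq hpq
          have e1 : ∑ i, b i * (p * D i + q * D' i)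
              = p * ∑ i, b i * D i + q * ∑ i, b i * D' i := by
            rw [Finset.mul_sum, Finset.mul_sum, ← Finset.sum_add_distrib]
            exact Finset.sum_congr rfl fun i _ => by ring
          have e2 : ∑ i, (p * D i + q * D' i) * ⟪c i, x⟫
              = p * ∑ i, D i * ⟪c i, x⟫ + q * ∑ i, D' i * ⟪c i, x⟫ := by
            rw [Finset.mul_sum, Finset.mul_sum, ← Finset.sum_add_distrib]
            exact Finset.sum_congr rfl fun i _ => by ring
          rw [Finset.sum_add_distrib, ← Finset.mul_sum, ← Finset.mul_sum] at hlog
          simp only [G, Pi.add_apply, Pi.smul_apply, smul_eq_mul]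
          rw [e1, e2]
          have e3 : ⟪x, y⟫ = p * ⟪x, y⟫ + q * ⟪x, y⟫ := by rw [← add_mul, hpq, one_mul]
          linarith
        exact QuasiconvexOn.monotone_comp (g := Real.toEReal) hmono hc.quasiconvexOn
      · exact convex_univ
      · intro D _
        refine ContinuousOn.upperSemicontinuousOn (Continuous.continuousOn ?_)
        apply continuous_coe_real_ereal.comp
        fun_prop
      · intro D _
        have hc : ConcaveOn ℝ (Set.univ : Set (EuclideanSpace ℝ (Fin d))) (fun x => G D x) := by
          refine ⟨convex_univ, ?_⟩
          intro x _ x' _ p q hp hq hpq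
          apply le_of_eq
          simp only [G, ← hin, inner_add_left, real_inner_smul_left, smul_eq_mul]
          linear_combination (∑ i, D i * Real.log (D i) - ∑ i, b i * D i) * hpq
        exact QuasiconcaveOn.monotone_comp (g := Real.toEReal) hmono hc.quasiconcaveOn
    calc _ ≤ (⨅ D ∈ stdSimplex ℝ (Fin n),
          ⨆ x ∈ (Set.univ : Set (EuclideanSpace ℝ (Fin d))), ((G D x : ℝ) : EReal)) := by
          refine le_iInf₂ fun D hD => ?_
          by_cases hy : ∑ i, D i • c i = y
          · refine (iInf₂_le D ⟨hD.1, hD.2, hy⟩).trans ?_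
            refine le_trans ?_ (le_iSup₂ (0 : EuclideanSpace ℝ (Fin d)) (Set.mem_univ _))
            simp [G]
          · refine le_top.trans (top_le_iff.2 ?_).ge
            rw [EReal.eq_top_iff_forall_lt]
            intro r
            set w := y - ∑ i, D i • c i with hw
            have hw0 : 0 < ⟪w, w⟫ := real_inner_self_pos.2 (sub_ne_zero.2 (Ne.symm hy))
            set A := ∑ i, D i * Real.log (D i) - ∑ i, b i * D i with hA
            refine lt_of_lt_of_le ?_
              (le_iSup₂ (((r - A + 1) / ⟪w, w⟫) • w) (Set.mem_univ _))
            apply EReal.coe_lt_coe_iff.2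
            simp only [G, ← hin]
            rw [← inner_sub_right, ← hw, ← hA, real_inner_smul_left, div_mul_cancel₀ _ hw0.ne']
            linarith
      _ = _ := hmm
      _ ≤ _ := by
          refine iSup₂_le fun x _ => le_iSup_of_le x ?_
          obtain ⟨D, hD, hE⟩ := gibbs_eq_aux hn (fun i => ⟪c i, x⟫ + b i)
          refine (iInf₂_le D hD).trans (EReal.coe_le_coe_iff.2 ?_)
          rw [hsp] at hE
          simp only [G]
          linarith
end

section
/- Fix b ∈ ℝ^n and a matrix C ∈ ℝ^{n×d} with rows c₁, …, c_n ∈ ℝ^d, and define f : ℝ^d → ℝ by f(x) = log( Σ_{i=1}^n e^{⟨c_i, x⟩ + b_i} ). Then f is smooth (C^∞), and for all x, u, v ∈ ℝ^d the third derivative satisfies | D³f(x)(v, u, u) | ≤ D(C) · ‖v‖ · D²f(x)(u, u), where D(C) = max_{1 ≤ i, j ≤ n} ‖c_i − c_j‖ and D²f(x), D³f(x) denote the second and third Fréchet derivatives of f at x as multilinear forms. (That is, f is (2, D(C))-generalized self-concordant.) -/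
open scoped RealInnerProductSpace

namespace LSE

variable {n d : ℕ}

/-- weights -/
noncomputable def w (b : Fin n → ℝ) (c : Fin n → EuclideanSpace ℝ (Fin d)) (i : Fin n)
    (x : EuclideanSpace ℝ (Fin d)) : ℝ := Real.exp (⟪c i, x⟫ + b i)

/-- weighted average -/
noncomputable def A (b : Fin n → ℝ) (c : Fin n → EuclideanSpace ℝ (Fin d)) (g : Fin n → ℝ)
    (x : EuclideanSpace ℝ (Fin d)) : ℝ := (∑ i, w b c i x * g i) / ∑ i, w b c i x

lemma w_hasFDerivAt (b : Fin n → ℝ) (c : Fin n → EuclideanSpace ℝ (Fin d)) (i : Fin n)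
    (x : EuclideanSpace ℝ (Fin d)) :
    HasFDerivAt (w b c i) (w b c i x • innerSL ℝ (c i)) x := by
  have h := ((innerSL ℝ (c i)).hasFDerivAt (x := x)).add_const (b i)
  exact h.exp

lemma sum_hasFDerivAt (b : Fin n → ℝ) (c : Fin n → EuclideanSpace ℝ (Fin d)) (g : Fin n → ℝ)
    (x : EuclideanSpace ℝ (Fin d)) :
    HasFDerivAt (fun y => ∑ i, w b c i y * g i)
      (∑ i, g i • (w b c i x • innerSL ℝ (c i))) x :=
  HasFDerivAt.fun_sum fun i _ => (w_hasFDerivAt b c i x).mul_const (g i)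

lemma S_hasFDerivAt (b : Fin n → ℝ) (c : Fin n → EuclideanSpace ℝ (Fin d))
    (x : EuclideanSpace ℝ (Fin d)) :
    HasFDerivAt (fun y => ∑ i, w b c i y)
      (∑ i, (w b c i x • innerSL ℝ (c i))) x :=
  HasFDerivAt.fun_sum fun i _ => (w_hasFDerivAt b c i x)

lemma S_pos [NeZero n] (b : Fin n → ℝ) (c : Fin n → EuclideanSpace ℝ (Fin d))
    (x : EuclideanSpace ℝ (Fin d)) : 0 < ∑ i, w b c i x :=
  Finset.sum_pos (fun _ _ => Real.exp_pos _) ⟨0, Finset.mem_univ _⟩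

lemma A_hasFDerivAt [NeZero n] (b : Fin n → ℝ) (c : Fin n → EuclideanSpace ℝ (Fin d))
    (g : Fin n → ℝ) (x : EuclideanSpace ℝ (Fin d)) :
    HasFDerivAt (A b c g) ((∑ i, w b c i x * g i) •
        (-((∑ i, w b c i x) ^ 2)⁻¹ • ∑ i, (w b c i x • innerSL ℝ (c i)))
      + (∑ i, w b c i x)⁻¹ • ∑ i, g i • (w b c i x • innerSL ℝ (c i))) x := by
  have h := (sum_hasFDerivAt b c g x).mul
    ((hasDerivAt_inv (S_pos b c x).ne').comp_hasFDerivAt x (S_hasFDerivAt b c x))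
  exact h

lemma A_diff [NeZero n] (b : Fin n → ℝ) (c : Fin n → EuclideanSpace ℝ (Fin d)) (g : Fin n → ℝ)
    (x : EuclideanSpace ℝ (Fin d)) : DifferentiableAt ℝ (A b c g) x :=
  (A_hasFDerivAt b c g x).differentiableAt

lemma A_fderiv [NeZero n] (b : Fin n → ℝ) (c : Fin n → EuclideanSpace ℝ (Fin d)) (g : Fin n → ℝ)
    (x v : EuclideanSpace ℝ (Fin d)) :
    fderiv ℝ (A b c g) x v =
      A b c (fun i => g i * ⟪c i, v⟫) x - A b c g x * A b c (fun i => ⟪c i, v⟫) x := by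
  have hS := (S_pos b c x).ne'
  rw [(A_hasFDerivAt b c g x).fderiv]
  have e : ∑ i, g i * (w b c i x * ⟪c i, v⟫) = ∑ i, w b c i x * (g i * ⟪c i, v⟫) :=
    Finset.sum_congr rfl fun i _ => by ring
  simp only [A, _root_.smul_apply, _root_.add_apply,
    _root_.sum_apply, innerSL_apply_apply, smul_eq_mul, e]
  field_simp
  ring

lemma log_fderiv [NeZero n] (b : Fin n → ℝ) (c : Fin n → EuclideanSpace ℝ (Fin d))
    (x v : EuclideanSpace ℝ (Fin d)) :
    fderiv ℝ (fun y => Real.log (∑ i, w b c i y)) x v = A b c (fun i => ⟪c i, v⟫) x := by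
  have hS := (S_pos b c x).ne'
  rw [((S_hasFDerivAt b c x).log hS).fderiv]
  simp only [A, _root_.smul_apply,
    _root_.sum_apply, innerSL_apply_apply, smul_eq_mul]
  field_simp

lemma smooth [NeZero n] (b : Fin n → ℝ) (c : Fin n → EuclideanSpace ℝ (Fin d)) :
    ContDiff ℝ (⊤ : ℕ∞) (fun y => Real.log (∑ i, w b c i y)) := by
  refine ContDiff.log ?_ fun x => (S_pos b c x).ne'
  unfold w
  exact ContDiff.sum fun i _ =>
    Real.contDiff_exp.comp ((contDiff_const.inner ℝ contDiff_id).add contDiff_const)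

lemma iter_succ {E : Type*} [NormedAddCommGroup E] [NormedSpace ℝ E] {f : E → ℝ}
    (hf : ContDiff ℝ (⊤ : ℕ∞) f) (k : ℕ) (x v : E) (m : Fin k → E) :
    iteratedFDeriv ℝ (k + 1) f x (Matrix.vecCons v m) =
      fderiv ℝ (fun y => iteratedFDeriv ℝ k f y m) x v := by
  rw [iteratedFDeriv_succ_apply_left, fderiv_continuousMultilinear_apply_const_apply]
  · simp
  · exact (hf.differentiable_iteratedFDeriv (by exact_mod_cast WithTop.coe_lt_top k)) x

lemma D1 [NeZero n] (b : Fin n → ℝ) (c : Fin n → EuclideanSpace ℝ (Fin d))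
    (x u : EuclideanSpace ℝ (Fin d)) :
    iteratedFDeriv ℝ 1 (fun y => Real.log (∑ i, w b c i y)) x ![u]
      = A b c (fun i => ⟪c i, u⟫) x := by
  rw [iter_succ (smooth b c)]
  simpa using log_fderiv b c x u

lemma D2 [NeZero n] (b : Fin n → ℝ) (c : Fin n → EuclideanSpace ℝ (Fin d))
    (x u : EuclideanSpace ℝ (Fin d)) :
    iteratedFDeriv ℝ 2 (fun y => Real.log (∑ i, w b c i y)) x ![u, u]
      = A b c (fun i => ⟪c i, u⟫ * ⟪c i, u⟫) x
        - A b c (fun i => ⟪c i, u⟫) x * A b c (fun i => ⟪c i, u⟫) x := by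
  rw [iter_succ (smooth b c)]
  simp only [D1]
  exact A_fderiv b c _ x u

lemma D3 [NeZero n] (b : Fin n → ℝ) (c : Fin n → EuclideanSpace ℝ (Fin d))
    (x u v : EuclideanSpace ℝ (Fin d)) :
    iteratedFDeriv ℝ 3 (fun y => Real.log (∑ i, w b c i y)) x ![v, u, u]
      = A b c (fun i => ⟪c i, u⟫ * ⟪c i, u⟫ * ⟪c i, v⟫) x
        - A b c (fun i => ⟪c i, u⟫ * ⟪c i, u⟫) x * A b c (fun i => ⟪c i, v⟫) x
        - 2 * A b c (fun i => ⟪c i, u⟫) x * (A b c (fun i => ⟪c i, u⟫ * ⟪c i, v⟫) x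
          - A b c (fun i => ⟪c i, u⟫) x * A b c (fun i => ⟪c i, v⟫) x) := by
  rw [iter_succ (smooth b c)]
  simp only [D2]
  have h1 := A_diff b c (fun i => ⟪c i, u⟫ * ⟪c i, u⟫) x
  have h2 := A_diff b c (fun i => ⟪c i, u⟫) x
  rw [fderiv_fun_sub h1 (h2.fun_mul h2), fderiv_fun_mul h2 h2]
  simp only [_root_.smul_apply, _root_.sub_apply,
    _root_.add_apply, smul_eq_mul, A_fderiv]
  ring

/-- The moment inequality. -/
lemma moment (p a β : Fin n → ℝ) (K : ℝ) (hp : ∀ i, 0 ≤ p i) (h1 : ∑ i, p i = 1)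
    (hK : ∀ i j, |β i - β j| ≤ K) :
    |∑ i, p i * (a i * a i * β i) - (∑ i, p i * (a i * a i)) * (∑ i, p i * β i)
      - 2 * (∑ i, p i * a i) * ((∑ i, p i * (a i * β i)) - (∑ i, p i * a i) * ∑ i, p i * β i)|
    ≤ K * ((∑ i, p i * (a i * a i)) - (∑ i, p i * a i) * ∑ i, p i * a i) := by
  set m := ∑ i, p i * a i with hm
  set B := ∑ i, p i * β i with hB
  have e1 : ∑ i, p i * (a i - m) ^ 2 = (∑ i, p i * (a i * a i)) - m * m := by
    have : ∀ i, p i * (a i - m) ^ 2 = p i * (a i * a i) - 2 * m * (p i * a i) + m * m * p i :=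
      fun i => by ring
    simp only [this, Finset.sum_add_distrib, Finset.sum_sub_distrib, ← Finset.mul_sum, h1, ← hm]
    ring
  have e2 : ∑ i, p i * (a i - m) ^ 2 * (β i - B) =
      ∑ i, p i * (a i * a i * β i) - (∑ i, p i * (a i * a i)) * B
      - 2 * m * ((∑ i, p i * (a i * β i)) - m * B) := by
    have : ∀ i, p i * (a i - m) ^ 2 * (β i - B) = p i * (a i * a i * β i)
        - 2 * m * (p i * (a i * β i)) + m * m * (p i * β i)
        - B * (p i * (a i * a i)) + 2 * m * B * (p i * a i) - m * m * B * p i :=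
      fun i => by ring
    simp only [this, Finset.sum_add_distrib, Finset.sum_sub_distrib, ← Finset.mul_sum, h1, ← hm,
      ← hB]
    ring
  have e3 : ∀ i, |β i - B| ≤ K := by
    intro i
    have : β i - B = ∑ j, p j * (β i - β j) := by
      simp only [mul_sub, Finset.sum_sub_distrib, ← Finset.sum_mul, h1, ← hB, one_mul]
    rw [this]
    calc _ ≤ ∑ j, |p j * (β i - β j)| := Finset.abs_sum_le_sum_abs _ _
      _ ≤ ∑ j, p j * K := Finset.sum_le_sum fun j _ => by
          rw [abs_mul, abs_of_nonneg (hp j)]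
          exact mul_le_mul_of_nonneg_left (hK i j) (hp j)
      _ = K := by rw [← Finset.sum_mul, h1, one_mul]
  rw [← e1, ← e2, Finset.mul_sum]
  refine (Finset.abs_sum_le_sum_abs _ _).trans (Finset.sum_le_sum fun i _ => ?_)
  have h0 : 0 ≤ p i * (a i - m) ^ 2 := mul_nonneg (hp i) (sq_nonneg _)
  rw [abs_mul, abs_of_nonneg h0, mul_comm K]
  exact mul_le_mul_of_nonneg_left (e3 i) h0

lemma A_eq (b : Fin n → ℝ) (c : Fin n → EuclideanSpace ℝ (Fin d)) (g : Fin n → ℝ)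
    (x : EuclideanSpace ℝ (Fin d)) :
    A b c g x = ∑ i, (w b c i x / ∑ j, w b c j x) * g i := by
  rw [A, Finset.sum_div]
  exact Finset.sum_congr rfl fun i _ => by ring

lemma main [NeZero n] (b : Fin n → ℝ) (c : Fin n → EuclideanSpace ℝ (Fin d))
    (x u v : EuclideanSpace ℝ (Fin d)) :
    |iteratedFDeriv ℝ 3 (fun y => Real.log (∑ i, w b c i y)) x ![v, u, u]| ≤
      (⨆ i : Fin n, ⨆ j : Fin n, ‖c i - c j‖) * ‖v‖ *
        iteratedFDeriv ℝ 2 (fun y => Real.log (∑ i, w b c i y)) x ![u, u] := by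
  rw [D2, D3]
  simp only [A_eq]
  have hS := S_pos b c x
  refine moment _ (fun i => ⟪c i, u⟫) (fun i => ⟪c i, v⟫) _
    (fun i => div_nonneg (Real.exp_pos _).le hS.le) ?_ ?_
  · rw [← Finset.sum_div, div_self hS.ne']
  · intro i j
    have hle : ‖c i - c j‖ ≤ ⨆ i : Fin n, ⨆ j : Fin n, ‖c i - c j‖ :=
      (le_ciSup (f := fun j => ‖c i - c j‖) (Set.finite_range _).bddAbove j).trans
        (le_ciSup (f := fun i => ⨆ j, ‖c i - c j‖) (Set.finite_range _).bddAbove i)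
    simp only [← inner_sub_left]
    exact (abs_real_inner_le_norm _ _).trans (mul_le_mul_of_nonneg_right hle (norm_nonneg _))

end LSE

/-- the log-sum-exp potential `f(x) = log(Σᵢ exp(⟪cᵢ, x⟫ + bᵢ))` is smooth
and `(2, D(C))`-generalized self-concordant, where `D(C) = maxᵢⱼ ‖cᵢ - cⱼ‖`:
`|D³f(x)(v,u,u)| ≤ D(C) ‖v‖ D²f(x)(u,u)`. -/
theorem stmt_14 {n d : ℕ} (b : Fin n → ℝ) (c : Fin n → EuclideanSpace ℝ (Fin d)) :
    ContDiff ℝ (⊤ : ℕ∞) (fun x : EuclideanSpace ℝ (Fin d) =>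
        Real.log (∑ i, Real.exp (⟪c i, x⟫ + b i))) ∧
    ∀ x u v : EuclideanSpace ℝ (Fin d),
      |iteratedFDeriv ℝ 3
          (fun x : EuclideanSpace ℝ (Fin d) => Real.log (∑ i, Real.exp (⟪c i, x⟫ + b i)))
          x ![v, u, u]|
        ≤ (⨆ i : Fin n, ⨆ j : Fin n, ‖c i - c j‖) * ‖v‖ *
          iteratedFDeriv ℝ 2
            (fun x : EuclideanSpace ℝ (Fin d) => Real.log (∑ i, Real.exp (⟪c i, x⟫ + b i)))
            x ![u, u] := by

  rcases Nat.eq_zero_or_pos n with rfl | hn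
  · refine ⟨by simpa using contDiff_const, fun x u v => ?_⟩
    have e : (fun x : EuclideanSpace ℝ (Fin d) =>
        Real.log (∑ i : Fin 0, Real.exp (⟪c i, x⟫ + b i))) = fun _ => 0 := by
      funext x; simp
    rw [e]
    simp
  · have : NeZero n := ⟨hn.ne'⟩
    exact ⟨LSE.smooth b c, LSE.main b c⟩
end

section
/- Let ε > 0, let y₁, …, y_n ∈ ℝ^d, and let w₁, …, w_n > 0. Define f : ℝ^d → ℝ by f(x) = ε · log( Σ_{i=1}^n w_i e^{⟨x, y_i⟩/ε} ). Then f is smooth and for all x, u, v ∈ ℝ^d: | D³f(x)(v, u, u) | ≤ (D/ε) · ‖v‖ · D²f(x)(u, u), where D = max_{1 ≤ i, j ≤ n} ‖y_i − y_j‖. (That is, the Sinkhorn Brenier potential built on the points y₁,…,y_n is (2, D/ε)-generalized self-concordant.) -/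
open scoped RealInnerProductSpace

noncomputable section

/-- Weighted exponential moment. -/
def momP {n d : ℕ} (ε : ℝ) (y : Fin n → EuclideanSpace ℝ (Fin d)) (w c : Fin n → ℝ)
    (x : EuclideanSpace ℝ (Fin d)) : ℝ :=
  ∑ i, c i * (w i * Real.exp (⟪x, y i⟫ / ε))

theorem momP_contDiff {n d : ℕ} (ε : ℝ) (y : Fin n → EuclideanSpace ℝ (Fin d))
    (w c : Fin n → ℝ) (m : WithTop ℕ∞) : ContDiff ℝ m (momP ε y w c) := by
  unfold momP
  refine ContDiff.sum fun i _ => ?_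
  refine contDiff_const.mul (contDiff_const.mul (Real.contDiff_exp.comp ?_))
  exact (contDiff_id.inner ℝ contDiff_const).div_const _

theorem momP_line {n d : ℕ} (ε : ℝ) (y : Fin n → EuclideanSpace ℝ (Fin d))
    (w c : Fin n → ℝ) (x v : EuclideanSpace ℝ (Fin d)) :
    HasDerivAt (fun t : ℝ => momP ε y w c (x + t • v))
      (ε⁻¹ * momP ε y w (fun i => c i * ⟪v, y i⟫) x) 0 := by
  unfold momP
  rw [Finset.mul_sum]
  refine HasDerivAt.fun_sum fun i _ => ?_
  have h1 : HasDerivAt (fun t : ℝ => ⟪x + t • v, y i⟫ / ε) (⟪v, y i⟫ / ε) 0 := by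
    have : HasDerivAt (fun t : ℝ => (⟪x, y i⟫ + t * ⟪v, y i⟫) / ε) ((1 * ⟪v, y i⟫) / ε) 0 :=
      (((hasDerivAt_id (0:ℝ)).mul_const _).const_add _).div_const _
    simpa [inner_add_left, real_inner_smul_left] using this
  have h2 := (h1.exp.const_mul (w i)).const_mul (c i)
  refine h2.congr_deriv ?_
  simp
  ring

theorem momP_pos {n d : ℕ} (ε : ℝ) (y : Fin n → EuclideanSpace ℝ (Fin d))
    (w : Fin n → ℝ) (hw : ∀ i, 0 < w i) [Nonempty (Fin n)]
    (x : EuclideanSpace ℝ (Fin d)) : 0 < momP ε y w (fun _ => 1) x := by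
  unfold momP
  refine Finset.sum_pos (fun i _ => ?_) Finset.univ_nonempty
  have := hw i
  positivity

theorem fderiv_of_line {d : ℕ} {F : EuclideanSpace ℝ (Fin d) → ℝ}
    {x v : EuclideanSpace ℝ (Fin d)} {a : ℝ} (hF : DifferentiableAt ℝ F x)
    (h : HasDerivAt (fun t : ℝ => F (x + t • v)) a 0) : fderiv ℝ F x v = a := by
  have h1 : HasLineDerivAt ℝ F (fderiv ℝ F x v) x v := hF.hasFDerivAt.hasLineDerivAt v
  exact HasDerivAt.unique h1 h

theorem iter_step {d k : ℕ} {F G : EuclideanSpace ℝ (Fin d) → ℝ} (hF : ContDiff ℝ (⊤ : ℕ∞) F)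
    (m : Fin k → EuclideanSpace ℝ (Fin d))
    (hG : ∀ x, iteratedFDeriv ℝ k F x m = G x) (hGd : Differentiable ℝ G)
    (x v : EuclideanSpace ℝ (Fin d)) {a : ℝ}
    (h : HasDerivAt (fun t : ℝ => G (x + t • v)) a 0) :
    iteratedFDeriv ℝ (k + 1) F x (Matrix.vecCons v m) = a := by
  have hd : DifferentiableAt ℝ (iteratedFDeriv ℝ k F) x :=
    (hF.differentiable_iteratedFDeriv (by exact_mod_cast ENat.natCast_lt_top k)) x
  rw [hd.iteratedFDeriv_succ_apply_left']
  have : (fun x => iteratedFDeriv ℝ k F x (Fin.tail (Matrix.vecCons v m))) = G := by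
    funext z
    exact hG z
  simp only [this]
  exact fderiv_of_line (hGd x) h

theorem center_bound {n d : ℕ} (ε : ℝ) (y : Fin n → EuclideanSpace ℝ (Fin d))
    (w : Fin n → ℝ) (hw : ∀ i, 0 < w i) [Nonempty (Fin n)]
    (x v : EuclideanSpace ℝ (Fin d)) (i : Fin n) :
    |⟪v, y i⟫ - momP ε y w (fun i => ⟪v, y i⟫) x / momP ε y w (fun _ => 1) x|
      ≤ (⨆ i : Fin n, ⨆ j : Fin n, ‖y i - y j‖) * ‖v‖ := by
  have hS := momP_pos ε y w hw x
  set S := momP ε y w (fun _ => 1) x with hSdef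
  set M := (⨆ i : Fin n, ⨆ j : Fin n, ‖y i - y j‖)
  have hM : ∀ j, ‖y i - y j‖ ≤ M := fun j =>
    (le_ciSup (f := fun j => ‖y i - y j‖) (Set.finite_range _).bddAbove j).trans
      (le_ciSup (f := fun i => ⨆ j, ‖y i - y j‖) (Set.finite_range _).bddAbove i)
  have e : ⟪v, y i⟫ - momP ε y w (fun i => ⟪v, y i⟫) x / S
      = momP ε y w (fun j => ⟪v, y i - y j⟫) x / S := by
    have : momP ε y w (fun j => ⟪v, y i - y j⟫) x
      = ⟪v, y i⟫ * S - momP ε y w (fun i => ⟪v, y i⟫) x := by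
      rw [hSdef]
      unfold momP
      rw [Finset.mul_sum, ← Finset.sum_sub_distrib]
      refine Finset.sum_congr rfl fun j _ => ?_
      simp only [inner_sub_right]; ring
    rw [this]; field_simp
  rw [e, abs_div, abs_of_pos hS, div_le_iff₀ hS, hSdef]
  unfold momP
  rw [Finset.mul_sum]
  refine (Finset.abs_sum_le_sum_abs _ _).trans (Finset.sum_le_sum fun j _ => ?_)
  have hp : 0 < w j * Real.exp (⟪x, y j⟫ / ε) := mul_pos (hw j) (Real.exp_pos _)
  rw [abs_mul, abs_of_pos hp, one_mul]
  refine mul_le_mul_of_nonneg_right ?_ hp.le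
  refine (abs_real_inner_le_norm _ _).trans ?_
  rw [mul_comm]
  exact mul_le_mul_of_nonneg_right (hM j) (norm_nonneg _)

end


/-- the Sinkhorn Brenier potential `f(x) = ε log(Σᵢ wᵢ exp(⟪x, yᵢ⟫/ε))` is
smooth and `(2, D/ε)`-generalized self-concordant, where `D = maxᵢⱼ ‖yᵢ - yⱼ‖`:
`|D³f(x)(v,u,u)| ≤ (D/ε) ‖v‖ D²f(x)(u,u)`. -/
theorem stmt_15 {n d : ℕ} (ε : ℝ) (hε : 0 < ε)
    (y : Fin n → EuclideanSpace ℝ (Fin d))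
    (w : Fin n → ℝ) (hw : ∀ i, 0 < w i) :
    ContDiff ℝ (⊤ : ℕ∞) (fun x : EuclideanSpace ℝ (Fin d) =>
        ε * Real.log (∑ i, w i * Real.exp (⟪x, y i⟫ / ε))) ∧
    ∀ x u v : EuclideanSpace ℝ (Fin d),
      |iteratedFDeriv ℝ 3
          (fun x : EuclideanSpace ℝ (Fin d) =>
            ε * Real.log (∑ i, w i * Real.exp (⟪x, y i⟫ / ε)))
          x ![v, u, u]|
        ≤ (⨆ i : Fin n, ⨆ j : Fin n, ‖y i - y j‖) / ε * ‖v‖ *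
          iteratedFDeriv ℝ 2
            (fun x : EuclideanSpace ℝ (Fin d) =>
              ε * Real.log (∑ i, w i * Real.exp (⟪x, y i⟫ / ε)))
            x ![u, u] := by

  rcases isEmpty_or_nonempty (Fin n) with hn | hn
  · have h0 : (fun x : EuclideanSpace ℝ (Fin d) =>
        ε * Real.log (∑ i, w i * Real.exp (⟪x, y i⟫ / ε))) = fun _ => 0 := by
      funext x; simp
    rw [h0]
    refine ⟨contDiff_const, fun x u v => ?_⟩
    have h3 : iteratedFDeriv ℝ 3 (fun _ : EuclideanSpace ℝ (Fin d) => (0:ℝ)) = 0 :=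
      iteratedFDeriv_fun_zero
    have h2 : iteratedFDeriv ℝ 2 (fun _ : EuclideanSpace ℝ (Fin d) => (0:ℝ)) = 0 :=
      iteratedFDeriv_fun_zero
    rw [h3, h2]
    simp
  have hfe : (fun x : EuclideanSpace ℝ (Fin d) =>
        ε * Real.log (∑ i, w i * Real.exp (⟪x, y i⟫ / ε)))
      = fun x => ε * Real.log (momP ε y w (fun _ => 1) x) := by
    funext x; simp [momP]
  rw [hfe]
  set f := fun x => ε * Real.log (momP ε y w (fun _ => 1) x) with hf
  have hS : ∀ x, 0 < momP ε y w (fun _ => 1) x := momP_pos ε y w hw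
  have hS0 : ∀ x, momP ε y w (fun _ => 1) x ≠ 0 := fun x => (hS x).ne'
  have hsm : ContDiff ℝ (⊤ : ℕ∞) f :=
    contDiff_const.mul ((momP_contDiff ε y w _ _).log hS0)
  refine ⟨hsm, fun x u v => ?_⟩
  have hdP : ∀ c, Differentiable ℝ (momP ε y w c) := fun c =>
    (momP_contDiff ε y w c 1).differentiable (by norm_num)
  have hε0 := hε.ne'
  let G1 : EuclideanSpace ℝ (Fin d) → ℝ := fun x =>
    momP ε y w (fun i => ⟪u, y i⟫) x / momP ε y w (fun _ => 1) x
  let G2 : EuclideanSpace ℝ (Fin d) → ℝ := fun x =>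
    ε⁻¹ * (momP ε y w (fun i => ⟪u, y i⟫ * ⟪u, y i⟫) x / momP ε y w (fun _ => 1) x
      - G1 x * G1 x)
  have hdQ : ∀ c, Differentiable ℝ
      (fun x => momP ε y w c x / momP ε y w (fun _ => 1) x) := fun c =>
    ((momP_contDiff ε y w c 1).div (momP_contDiff ε y w _ 1) hS0).differentiable (by norm_num)
  have hG1d : Differentiable ℝ G1 := hdQ _
  have hG2d : Differentiable ℝ G2 :=
    ((hdQ _).sub (hG1d.mul hG1d)).const_mul _
  have h1 : ∀ x, iteratedFDeriv ℝ 1 f x ![u] = G1 x := by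
    intro x
    refine iter_step hsm ![] (G := f) (fun x => by simp) (hsm.differentiable (by simp)) x u ?_
    have := ((momP_line ε y w (fun _ => 1) x u).log (by simpa using hS0 x)).const_mul ε
    refine this.congr_deriv ?_
    simp only [zero_smul, add_zero, one_mul, G1]
    field_simp
  have hline1 : ∀ x v, HasDerivAt (fun t : ℝ => G1 (x + t • v))
      (ε⁻¹ * (momP ε y w (fun i => ⟪u, y i⟫ * ⟪v, y i⟫) x / momP ε y w (fun _ => 1) x
        - G1 x * (momP ε y w (fun i => ⟪v, y i⟫) x / momP ε y w (fun _ => 1) x))) 0 := by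
    intro x v
    have := (momP_line ε y w (fun i => ⟪u, y i⟫) x v).fun_div
      (momP_line ε y w (fun _ => 1) x v) (by simpa using hS0 x)
    refine this.congr_deriv ?_
    have := hS0 x
    simp only [zero_smul, add_zero, one_mul, G1]
    field_simp
  have h2 : ∀ x, iteratedFDeriv ℝ 2 f x ![u, u] = G2 x := by
    intro x
    exact iter_step hsm ![u] h1 hG1d x u (hline1 x u)
  have hl2 := (((momP_line ε y w (fun i => ⟪u, y i⟫ * ⟪u, y i⟫) x v).fun_div
      (momP_line ε y w (fun _ => 1) x v) (by simpa using hS0 x)).fun_sub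
        ((hline1 x v).fun_mul (hline1 x v))).const_mul ε⁻¹
  have h3 := iter_step hsm ![u, u] h2 hG2d x v hl2
  set A := momP ε y w (fun i => ⟪u, y i⟫) x / momP ε y w (fun _ => 1) x with hA
  set B := momP ε y w (fun i => ⟪v, y i⟫) x / momP ε y w (fun _ => 1) x with hB
  have e2 : G2 x = ε⁻¹ * (momP ε y w (fun i => (⟪u, y i⟫ - A) ^ 2) x
      / momP ε y w (fun _ => 1) x) := by
    have : momP ε y w (fun i => (⟪u, y i⟫ - A) ^ 2) x
        = momP ε y w (fun i => ⟪u, y i⟫ * ⟪u, y i⟫) x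
          - 2 * A * momP ε y w (fun i => ⟪u, y i⟫) x + A ^ 2 * momP ε y w (fun _ => 1) x := by
      unfold momP
      simp only [Finset.mul_sum, ← Finset.sum_sub_distrib, ← Finset.sum_add_distrib]
      refine Finset.sum_congr rfl fun j _ => ?_
      ring
    rw [this]
    have := hS0 x
    simp only [G2, G1, hA]
    field_simp
    ring
  have e3 : iteratedFDeriv ℝ 3 f x ![v, u, u]
      = ε⁻¹ * ε⁻¹ * (momP ε y w (fun i => (⟪v, y i⟫ - B) * (⟪u, y i⟫ - A) ^ 2) x
      / momP ε y w (fun _ => 1) x) := by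
    have : momP ε y w (fun i => (⟪v, y i⟫ - B) * (⟪u, y i⟫ - A) ^ 2) x
        = momP ε y w (fun i => ⟪u, y i⟫ * ⟪u, y i⟫ * ⟪v, y i⟫) x
          - 2 * A * momP ε y w (fun i => ⟪u, y i⟫ * ⟪v, y i⟫) x
          + A ^ 2 * momP ε y w (fun i => ⟪v, y i⟫) x
          - B * momP ε y w (fun i => ⟪u, y i⟫ * ⟪u, y i⟫) x
          + 2 * A * B * momP ε y w (fun i => ⟪u, y i⟫) x
          - A ^ 2 * B * momP ε y w (fun _ => 1) x := by
      unfold momP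
      simp only [Finset.mul_sum, ← Finset.sum_sub_distrib, ← Finset.sum_add_distrib]
      refine Finset.sum_congr rfl fun j _ => ?_
      ring
    refine h3.trans ?_
    rw [this]
    have := hS0 x
    simp only [zero_smul, add_zero, one_mul, G1, hA, hB]
    field_simp
    ring
  rw [e3, h2, e2]
  set M := (⨆ i : Fin n, ⨆ j : Fin n, ‖y i - y j‖)
  have key : |momP ε y w (fun i => (⟪v, y i⟫ - B) * (⟪u, y i⟫ - A) ^ 2) x|
      ≤ M * ‖v‖ * momP ε y w (fun i => (⟪u, y i⟫ - A) ^ 2) x := by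
    unfold momP
    rw [Finset.mul_sum]
    refine (Finset.abs_sum_le_sum_abs _ _).trans (Finset.sum_le_sum fun j _ => ?_)
    have hp : 0 < w j * Real.exp (⟪x, y j⟫ / ε) := mul_pos (hw j) (Real.exp_pos _)
    rw [abs_mul, abs_mul, abs_of_pos hp, abs_of_nonneg (sq_nonneg (⟪u, y j⟫ - A)), mul_assoc]
    exact mul_le_mul_of_nonneg_right (center_bound ε y w hw x v j)
      (mul_nonneg (sq_nonneg _) hp.le)
  have hi : 0 < ε⁻¹ := inv_pos.mpr hε
  rw [abs_mul, abs_div, abs_of_pos (hS x), abs_of_pos (mul_pos hi hi)]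
  calc _ ≤ ε⁻¹ * ε⁻¹ * (M * ‖v‖ * momP ε y w (fun i => (⟪u, y i⟫ - A) ^ 2) x
        / momP ε y w (fun _ => 1) x) :=
        mul_le_mul_of_nonneg_left (div_le_div_of_nonneg_right key (hS x).le) (mul_pos hi hi).le
    _ = _ := by ring
end

section
/- Let ε > 0, let y₁, …, y_n ∈ ℝ^d, and let w₁, …, w_n > 0. Define f : ℝ^d → ℝ by f(x) = ε · log( Σ_{i=1}^n w_i e^{⟨x, y_i⟩/ε} ). Then for all x, u ∈ ℝ^d, 0 ≤ D²f(x)(u, u) ≤ (D²/ε) ‖u‖², where D = max_{1 ≤ i, j ≤ n} ‖y_i − y_j‖. In particular ∇f is (D²/ε)-Lipschitz, i.e., the Sinkhorn Brenier potential is (D²/ε)-smooth. -/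
open scoped RealInnerProductSpace

theorem aux_main {n d : ℕ} (hn : 0 < n) (ε : ℝ) (hε : 0 < ε)
    (y : Fin n → EuclideanSpace ℝ (Fin d))
    (w : Fin n → ℝ) (hw : ∀ i, 0 < w i)
    (f : EuclideanSpace ℝ (Fin d) → ℝ)
    (hf : ∀ x, f x = ε * Real.log (∑ i, w i * Real.exp (⟪x, y i⟫ / ε)))
    (D : ℝ) (hyD : ∀ i j, ‖y i - y j‖ ≤ D) :
    ∃ (g : EuclideanSpace ℝ (Fin d) → EuclideanSpace ℝ (Fin d))
      (G : EuclideanSpace ℝ (Fin d) → EuclideanSpace ℝ (Fin d) →L[ℝ] EuclideanSpace ℝ (Fin d)),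
      (∀ x, HasFDerivAt f (innerSL ℝ (g x)) x) ∧ (∀ x, HasFDerivAt g (G x) x) ∧
      (∀ x u, 0 ≤ ⟪G x u, u⟫) ∧ (∀ x u, ‖G x u‖ ≤ D ^ 2 / ε * ‖u‖) := by
  have : Nonempty (Fin n) := ⟨⟨0, hn⟩⟩
  let a : Fin n → EuclideanSpace ℝ (Fin d) → ℝ := fun i x => w i * Real.exp (⟪x, y i⟫ / ε)
  let S : EuclideanSpace ℝ (Fin d) → ℝ := fun x => ∑ i, a i x
  have ha0 : ∀ i x, 0 < a i x := fun i x => mul_pos (hw i) (Real.exp_pos _)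
  have hS0 : ∀ x, 0 < S x := fun x => Finset.sum_pos (fun i _ => ha0 i x) Finset.univ_nonempty
  have ha : ∀ i x, HasFDerivAt (a i) ((a i x / ε) • innerSL ℝ (y i)) x := by
    intro i x
    have h1 : HasFDerivAt (fun x : EuclideanSpace ℝ (Fin d) => ⟪x, y i⟫) (innerSL ℝ (y i)) x := by
      have := (innerSL ℝ (y i)).hasFDerivAt (x := x)
      refine this.congr_of_eventuallyEq (Filter.Eventually.of_forall fun z => ?_)
      simp [real_inner_comm]
    have h2 := ((h1.mul_const ε⁻¹).exp).const_mul (w i)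
    refine HasFDerivAt.congr_fderiv h2 ?_
    ext1 u
    simp only [a, div_eq_mul_inv, _root_.smul_apply, smul_eq_mul]
    ring
  have hS : ∀ x, HasFDerivAt S (∑ i, (a i x / ε) • innerSL ℝ (y i)) x := fun x =>
    HasFDerivAt.fun_sum fun i _ => ha i x
  let N : EuclideanSpace ℝ (Fin d) → EuclideanSpace ℝ (Fin d) := fun x => ∑ i, a i x • y i
  let g : EuclideanSpace ℝ (Fin d) → EuclideanSpace ℝ (Fin d) := fun x => (S x)⁻¹ • N x
  have hN : ∀ x, HasFDerivAt N (∑ i, ((a i x / ε) • innerSL ℝ (y i)).smulRight (y i)) x := fun x =>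
    HasFDerivAt.fun_sum fun i _ => (ha i x).smul_const (y i)
  let p : Fin n → EuclideanSpace ℝ (Fin d) → ℝ := fun i x => (S x)⁻¹ * a i x
  have hp0 : ∀ i x, 0 ≤ p i x := fun i x => (mul_pos (inv_pos.2 (hS0 x)) (ha0 i x)).le
  have hp1 : ∀ x, ∑ i, p i x = 1 := fun x => by
    simp only [p, ← Finset.mul_sum]; exact inv_mul_cancel₀ (hS0 x).ne'
  have hgp : ∀ x, g x = ∑ i, p i x • y i := fun x => by
    simp only [g, N, p, Finset.smul_sum, smul_smul]
  have hc : ∀ x, ∑ i, p i x • (y i - g x) = 0 := fun x => by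
    simp only [smul_sub, Finset.sum_sub_distrib, ← Finset.sum_smul, hp1, ← hgp, one_smul, sub_self]
  have hyg : ∀ i x, ‖y i - g x‖ ≤ D := by
    intro i x
    have : y i - g x = ∑ j, p j x • (y i - y j) := by
      simp only [smul_sub, Finset.sum_sub_distrib, ← Finset.sum_smul, hp1, ← hgp, one_smul]
    rw [this]
    calc _ ≤ ∑ j, ‖p j x • (y i - y j)‖ := norm_sum_le _ _
      _ ≤ ∑ j, p j x * D := Finset.sum_le_sum fun j _ => by
        rw [norm_smul, Real.norm_of_nonneg (hp0 j x)]
        exact mul_le_mul_of_nonneg_left (hyD i j) (hp0 j x)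
      _ = D := by rw [← Finset.sum_mul, hp1, one_mul]
  let G : EuclideanSpace ℝ (Fin d) → EuclideanSpace ℝ (Fin d) →L[ℝ] EuclideanSpace ℝ (Fin d) :=
    fun x => ∑ i, (p i x / ε) • (innerSL ℝ (y i - g x)).smulRight (y i - g x)
  have hGu : ∀ x u, G x u = ∑ i, (p i x / ε * ⟪y i - g x, u⟫) • (y i - g x) := by
    intro x u
    simp only [G, _root_.sum_apply, _root_.smul_apply,
      ContinuousLinearMap.smulRight_apply, innerSL_apply_apply, smul_smul]
  have hc2 : ∀ x u, ∑ i, p i x * ⟪y i - g x, u⟫ = 0 := by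
    intro x u
    have := congrArg (fun z => ⟪z, u⟫) (hc x)
    simpa only [sum_inner, real_inner_smul_left, inner_zero_left] using this
  refine ⟨g, G, ?_, ?_, ?_, ?_⟩
  · intro x
    have h := ((hS x).log (hS0 x).ne').const_mul ε
    have hf' : f = fun x => ε * Real.log (S x) := funext hf
    rw [hf']
    refine HasFDerivAt.congr_fderiv h ?_
    ext1 u
    simp only [hgp, p, innerSL_apply_apply, sum_inner, real_inner_smul_left,
      _root_.sum_apply, _root_.smul_apply, smul_eq_mul, Finset.mul_sum]
    refine Finset.sum_congr rfl fun i _ => ?_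
    field_simp
  · intro x
    have h := ((hasDerivAt_inv (hS0 x).ne').comp_hasFDerivAt x (hS x)).smul (hN x)
    refine HasFDerivAt.congr_fderiv h ?_
    ext1 u
    rw [hGu]
    have e1 : ∑ i, (p i x / ε * ⟪y i - g x, u⟫) • (y i - g x)
        = ∑ i, (p i x / ε * ⟪y i - g x, u⟫) • y i := by
      simp only [smul_sub, Finset.sum_sub_distrib, ← Finset.sum_smul]
      have : ∑ i, p i x / ε * ⟪y i - g x, u⟫ = 0 := by
        have := congrArg (fun z => ε⁻¹ * z) (hc2 x u)
        simp only [Finset.mul_sum, mul_zero] at this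
        rw [← this]
        exact Finset.sum_congr rfl fun i _ => by ring
      rw [this, zero_smul, sub_zero]
    rw [e1]
    have e2 : ∑ i, a i x / ε * ⟪y i, u⟫ = S x / ε * ⟪g x, u⟫ := by
      rw [hgp, sum_inner, Finset.mul_sum]
      refine Finset.sum_congr rfl fun i _ => ?_
      rw [real_inner_smul_left]
      have := (hS0 x).ne'
      simp only [p]
      field_simp
    simp only [_root_.add_apply, _root_.sum_apply,
      _root_.smul_apply, ContinuousLinearMap.smulRight_apply, innerSL_apply_apply,
      smul_eq_mul, e2, Function.comp]
    simp only [N, Finset.smul_sum, smul_smul, ← Finset.sum_add_distrib, ← add_smul]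
    refine Finset.sum_congr rfl fun i _ => ?_
    congr 1
    have := (hS0 x).ne'
    simp only [p, inner_sub_left]
    field_simp
    ring
  · intro x u
    rw [hGu, sum_inner]
    refine Finset.sum_nonneg fun i _ => ?_
    rw [real_inner_smul_left, mul_assoc]
    exact mul_nonneg (div_nonneg (hp0 i x) hε.le) (mul_self_nonneg _)
  · intro x u
    rw [hGu]
    calc _ ≤ ∑ i, ‖(p i x / ε * ⟪y i - g x, u⟫) • (y i - g x)‖ := norm_sum_le _ _
      _ ≤ ∑ i, p i x * (D ^ 2 / ε * ‖u‖) := Finset.sum_le_sum fun i _ => by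
        rw [norm_smul, norm_mul, Real.norm_of_nonneg (div_nonneg (hp0 i x) hε.le)]
        have h1 := norm_inner_le_norm (𝕜 := ℝ) (y i - g x) u
        have h2 := hyg i x
        have h0 := norm_nonneg (y i - g x)
        have hp' := div_nonneg (hp0 i x) hε.le
        calc _ ≤ p i x / ε * (D * ‖u‖) * D := by
              have hD0 : 0 ≤ D := h0.trans h2
              have h5 : ‖⟪y i - g x, u⟫‖ ≤ D * ‖u‖ := h1.trans (by gcongr)
              have h6 : 0 ≤ p i x / ε * (D * ‖u‖) := by positivity
              exact mul_le_mul (mul_le_mul_of_nonneg_left h5 hp') h2 h0 h6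
          _ = _ := by ring
      _ = _ := by rw [← Finset.sum_mul, hp1, one_mul]

/-- the Sinkhorn Brenier potential `f(x) = ε log(Σᵢ wᵢ exp(⟪x, yᵢ⟫/ε))`
satisfies `0 ≤ D²f(x)(u,u) ≤ (D²/ε)‖u‖²` with `D = maxᵢⱼ ‖yᵢ - yⱼ‖`; in particular its
gradient is `(D²/ε)`-Lipschitz, i.e. `f` is `(D²/ε)`-smooth. -/
theorem stmt_17 {n d : ℕ} (ε : ℝ) (hε : 0 < ε)
    (y : Fin n → EuclideanSpace ℝ (Fin d))
    (w : Fin n → ℝ) (hw : ∀ i, 0 < w i)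
    (f : EuclideanSpace ℝ (Fin d) → ℝ)
    (hf : ∀ x, f x = ε * Real.log (∑ i, w i * Real.exp (⟪x, y i⟫ / ε)))
    (D : ℝ) (hD : D = ⨆ i : Fin n, ⨆ j : Fin n, ‖y i - y j‖) :
    (∀ x u : EuclideanSpace ℝ (Fin d),
      0 ≤ iteratedFDeriv ℝ 2 f x ![u, u] ∧
      iteratedFDeriv ℝ 2 f x ![u, u] ≤ D ^ 2 / ε * ‖u‖ ^ 2) ∧
    (∀ x₁ x₂ : EuclideanSpace ℝ (Fin d),
      ‖gradient f x₁ - gradient f x₂‖ ≤ D ^ 2 / ε * ‖x₁ - x₂‖) := by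
  have hyD : ∀ i j, ‖y i - y j‖ ≤ D := by
    intro i j
    rw [hD]
    refine le_trans ?_ (le_ciSup (Set.finite_range _).bddAbove i)
    exact le_ciSup (f := fun j => ‖y i - y j‖) (Set.finite_range _).bddAbove j
  obtain ⟨g, G, h1, h2, h3, h4⟩ : ∃ (g : EuclideanSpace ℝ (Fin d) → EuclideanSpace ℝ (Fin d))
      (G : EuclideanSpace ℝ (Fin d) → EuclideanSpace ℝ (Fin d) →L[ℝ] EuclideanSpace ℝ (Fin d)),
      (∀ x, HasFDerivAt f (innerSL ℝ (g x)) x) ∧ (∀ x, HasFDerivAt g (G x) x) ∧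
      (∀ x u, 0 ≤ ⟪G x u, u⟫) ∧ (∀ x u, ‖G x u‖ ≤ D ^ 2 / ε * ‖u‖) := by
    rcases Nat.eq_zero_or_pos n with rfl | hn
    · have hf0 : f = fun _ => 0 := funext fun x => by simp [hf]
      refine ⟨fun _ => 0, fun _ => 0, fun x => ?_, fun x => hasFDerivAt_const _ _, fun x u => ?_,
        fun x u => ?_⟩
      · rw [hf0, map_zero]; exact hasFDerivAt_const _ _
      · simp
      · simp only [_root_.zero_apply, norm_zero]; positivity
    · exact aux_main hn ε hε y w hw f hf D hyD
  have hfd : fderiv ℝ f = fun x => innerSL ℝ (g x) := funext fun x => (h1 x).fderiv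
  constructor
  · intro x u
    have h : iteratedFDeriv ℝ 2 f x ![u, u] = ⟪G x u, u⟫ := by
      rw [iteratedFDeriv_two_apply, hfd]
      have := ((innerSL ℝ (E := EuclideanSpace ℝ (Fin d))).hasFDerivAt (x := g x)).comp x (h2 x)
      have := HasFDerivAt.fderiv this
      simp only [Function.comp_def] at this
      rw [this]
      rfl
    rw [h]
    refine ⟨h3 x u, (real_inner_le_norm _ _).trans ?_⟩
    calc _ ≤ D ^ 2 / ε * ‖u‖ * ‖u‖ := by gcongr; exact h4 x u
      _ = _ := by ring
  · have hg : gradient f = g := by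
      funext x
      apply HasGradientAt.gradient
      rw [hasGradientAt_iff_hasFDerivAt]
      exact h1 x
    intro x₁ x₂
    rw [hg]
    exact convex_univ.norm_image_sub_le_of_norm_hasFDerivWithin_le
      (fun x _ => (h2 x).hasFDerivWithinAt)
      (fun x _ => ContinuousLinearMap.opNorm_le_bound _ (by positivity) (h4 x))
      (Set.mem_univ _) (Set.mem_univ _)
end
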